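/- Let R be a commutative Noetherian ring all of whose localizations at prime ideals are Cohen–Macaulay local rings, let m, n ≥ 1, let A be an m×n matrix over R with e := n − m, and suppose A has good degeneracy loci. Then for every integer k ≥ 0 such that I_{n−k+1}(A) is a proper ideal, the quotient ring R/I_{n−k+1}(A) is Cohen–Macaulay, i.e., its localization at every prime ideal is a Cohen–Macaulay local ring. -/

import Mathlib

/-- The determinantal ideal `I_t(A)` of an `m × n` matrix `A` over a commutative ring `R`,
generated by all `t × t` minors of `A`; by convention `I_t(A) = R` for `t ≤ 0` and
`I_t(A) = 0` for `t > min m n`. -/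
noncomputable def detIdeal {R : Type*} [CommRing R] {m n : ℕ}
    (A : Matrix (Fin m) (Fin n) R) (t : ℤ) : Ideal R :=
  Ideal.span { d : R | ∃ (f : Fin t.toNat → Fin m) (g : Fin t.toNat → Fin n),
    Function.Injective f ∧ Function.Injective g ∧ d = (A.submatrix f g).det }

/-- An `m × n` matrix `A` (with `e := n - m`) has *good degeneracy loci* if for every
`k ≥ 0`, every minimal prime over `I_{n-k+1}(A)` has height exactly `max 0 (k * (k - e))`. -/
def HasGoodDegLoci {R : Type*} [CommRing R] {m n : ℕ}
    (A : Matrix (Fin m) (Fin n) R) : Prop :=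
  ∀ (k : ℕ) (p : PrimeSpectrum R),
    p.asIdeal ∈ (detIdeal A ((n : ℤ) - k + 1)).minimalPrimes →
      Order.height p =
        (((max 0 ((k : ℤ) * ((k : ℤ) - ((n : ℤ) - (m : ℤ))))).toNat : ℕ) : ℕ∞)

/-- The depth of an ideal `I` in a commutative ring `R`: the supremum of the lengths of
regular sequences on `R` all of whose entries lie in `I`. -/
noncomputable def idealDepth {R : Type*} [CommRing R] (I : Ideal R) : ℕ∞ :=
  ⨆ (rs : List R) (_ : (∀ x ∈ rs, x ∈ I) ∧ RingTheory.Sequence.IsRegular R rs),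
    (rs.length : ℕ∞)

/-- A commutative ring is a Cohen–Macaulay local ring if it is local and its depth (the
depth of its maximal ideal) equals its Krull dimension. -/
def IsCMLocalRing (R : Type*) [CommRing R] : Prop :=
  IsLocalRing R ∧ ∀ M : Ideal R, M.IsMaximal → (idealDepth M : WithBot ℕ∞) = ringKrullDim R

section Minors

variable {S : Type*} [CommRing S] {m n : ℕ}

/-- The ideal generated by the `k × k` minors of `M` that use only the first `i` rows and the
first `j` columns. -/
def boundedMinors (M : Matrix (Fin m) (Fin n) S) (k i j : ℕ) : Ideal S :=
  Ideal.span {d | ∃ (f : Fin k → Fin m) (g : Fin k → Fin n),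
    (∀ l, (f l : ℕ) < i) ∧ (∀ l, (g l : ℕ) < j) ∧ d = (M.submatrix f g).det}

theorem det_mem_boundedMinors (M : Matrix (Fin m) (Fin n) S) {k i j : ℕ} {f : Fin k → Fin m}
    {g : Fin k → Fin n} (hf : ∀ l, (f l : ℕ) < i) (hg : ∀ l, (g l : ℕ) < j) :
    (M.submatrix f g).det ∈ boundedMinors M k i j :=
  Ideal.subset_span ⟨f, g, hf, hg, rfl⟩

theorem boundedMinors_le_iff {M : Matrix (Fin m) (Fin n) S} {k i j : ℕ} {I : Ideal S} :
    boundedMinors M k i j ≤ I ↔ ∀ (f : Fin k → Fin m) (g : Fin k → Fin n),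
      (∀ l, (f l : ℕ) < i) → (∀ l, (g l : ℕ) < j) → (M.submatrix f g).det ∈ I := by
  rw [boundedMinors, Ideal.span_le]
  constructor
  · intro h f g hf hg
    exact h ⟨f, g, hf, hg, rfl⟩
  · rintro h _ ⟨f, g, hf, hg, rfl⟩
    exact h f g hf hg

theorem boundedMinors_mono (M : Matrix (Fin m) (Fin n) S) (k : ℕ) {i i' j j' : ℕ}
    (hi : i ≤ i') (hj : j ≤ j') : boundedMinors M k i j ≤ boundedMinors M k i' j' :=
  boundedMinors_le_iff.2 fun _ _ hf hg =>
    det_mem_boundedMinors M (fun l => (hf l).trans_le hi) fun l => (hg l).trans_le hj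

theorem boundedMinors_zero (M : Matrix (Fin m) (Fin n) S) (i j : ℕ) :
    boundedMinors M 0 i j = ⊤ := by
  rw [Ideal.eq_top_iff_one]
  have := det_mem_boundedMinors M (k := 0) (i := i) (j := j) (f := Fin.elim0) (g := Fin.elim0)
    (fun l => l.elim0) fun l => l.elim0
  simpa using this

theorem boundedMinors_transpose (M : Matrix (Fin m) (Fin n) S) (k i j : ℕ) :
    boundedMinors M.transpose k j i = boundedMinors M k i j := by
  apply le_antisymm <;> rw [boundedMinors_le_iff] <;> intro f g hf hg
  · rw [← Matrix.det_transpose, Matrix.transpose_submatrix, Matrix.transpose_transpose]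
    exact det_mem_boundedMinors M hg hf
  · rw [← Matrix.det_transpose, Matrix.transpose_submatrix]
    exact det_mem_boundedMinors _ hg hf

theorem det_submatrix_eq_zero_of_not_injective {ι κ : Type*} (M : Matrix ι κ S) {k : ℕ}
    {f : Fin k → ι} (g : Fin k → κ) (hf : ¬ Function.Injective f) :
    (M.submatrix f g).det = 0 := by
  simp only [Function.Injective, not_forall] at hf
  obtain ⟨a, b, hab, hne⟩ := hf
  exact Matrix.det_zero_of_row_eq hne (by ext; simp [hab])

theorem det_submatrix_eq_zero_of_not_injective_right {ι κ : Type*} (M : Matrix ι κ S) {k : ℕ}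
    (f : Fin k → ι) {g : Fin k → κ} (hg : ¬ Function.Injective g) :
    (M.submatrix f g).det = 0 := by
  rw [← Matrix.det_transpose, Matrix.transpose_submatrix]
  exact det_submatrix_eq_zero_of_not_injective _ _ hg

theorem det_mem_of_expand {k : ℕ} {I : Ideal S} (N : Matrix (Fin (k + 1)) (Fin (k + 1)) S)
    (l : Fin (k + 1)) (h : ∀ q : Fin (k + 1), (N.submatrix l.succAbove q.succAbove).det ∈ I) :
    N.det ∈ I := by
  rw [Matrix.det_succ_row N l]
  exact I.sum_mem fun q _ => I.mul_mem_left _ (h q)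

theorem boundedMinors_succ_row_le (M : Matrix (Fin m) (Fin n) S) (k i j : ℕ) :
    boundedMinors M (k + 1) (i + 1) j ≤ boundedMinors M k i j := by
  rw [boundedMinors_le_iff]
  intro f g hf hg
  by_cases hinj : Function.Injective f
  swap
  · rw [det_submatrix_eq_zero_of_not_injective _ _ hinj]; exact zero_mem _
  obtain ⟨l, hl⟩ : ∃ l, ∀ q, (f (Fin.succAbove l q) : ℕ) < i := by
    by_cases h : ∃ l, (f l : ℕ) = i
    · obtain ⟨l, hl⟩ := h
      refine ⟨l, fun q => ?_⟩
      have h1 := hf (l.succAbove q)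
      have h2 : (f (l.succAbove q) : ℕ) ≠ i := fun h => by
        rw [← hl] at h
        exact Fin.succAbove_ne l q (hinj (Fin.ext h))
      omega
    · push Not at h
      refine ⟨0, fun q => ?_⟩
      have h1 := hf (Fin.succAbove 0 q)
      have := h (Fin.succAbove 0 q)
      omega
  refine det_mem_of_expand _ l fun q => ?_
  rw [Matrix.submatrix_submatrix]
  exact det_mem_boundedMinors M hl fun _ => hg _

theorem boundedMinors_succ_col_le (M : Matrix (Fin m) (Fin n) S) (k i j : ℕ) :
    boundedMinors M (k + 1) i (j + 1) ≤ boundedMinors M k i j := by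
  rw [← boundedMinors_transpose, ← boundedMinors_transpose M k]
  exact boundedMinors_succ_row_le _ _ _ _

theorem boundedMinors_eq_bot_of_row_lt (M : Matrix (Fin m) (Fin n) S) {k i : ℕ} (j : ℕ)
    (h : i < k) : boundedMinors M k i j = ⊥ := by
  rw [eq_bot_iff, boundedMinors_le_iff]
  intro f g hf _
  rw [Ideal.mem_bot]
  refine det_submatrix_eq_zero_of_not_injective _ _ fun hinj => ?_
  have := Fintype.card_le_of_injective (fun l => (⟨f l, hf l⟩ : Fin i)) fun a b hab =>
    hinj (Fin.ext (by simpa using hab))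
  simp at this
  omega

theorem boundedMinors_eq_bot_of_col_lt (M : Matrix (Fin m) (Fin n) S) {k j : ℕ} (i : ℕ)
    (h : j < k) : boundedMinors M k i j = ⊥ := by
  rw [← boundedMinors_transpose]
  exact boundedMinors_eq_bot_of_row_lt _ _ h

/-- A minor using a given row `c` is, up to sign, a minor whose first row is `c`. -/
theorem exists_cons_row {ι κ : Type*} (M : Matrix ι κ S) {k : ℕ} (f : Fin (k + 1) → ι)
    (g : Fin (k + 1) → κ) (l : Fin (k + 1)) :
    (M.submatrix f g).det = (-1) ^ (l : ℕ) *
      (M.submatrix (Fin.cons (f l) (f ∘ l.succAbove)) g).det := by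
  rw [Matrix.det_succ_row _ l, Matrix.det_succ_row_zero, Finset.mul_sum]
  refine Finset.sum_congr rfl fun q _ => ?_
  simp only [Matrix.submatrix_apply, Matrix.submatrix_submatrix, Fin.cons_zero]
  have : (Fin.cons (f l) (f ∘ l.succAbove) : Fin (k + 1) → ι) ∘ Fin.succ = f ∘ l.succAbove := by
    ext x; simp
  rw [this, pow_add]
  ring

theorem exists_cons_col {ι κ : Type*} (M : Matrix ι κ S) {k : ℕ} (f : Fin (k + 1) → ι)
    (g : Fin (k + 1) → κ) (l : Fin (k + 1)) :
    (M.submatrix f g).det = (-1) ^ (l : ℕ) *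
      (M.submatrix f (Fin.cons (g l) (g ∘ l.succAbove))).det := by
  have := exists_cons_row M.transpose g f l
  rwa [← Matrix.det_transpose, Matrix.transpose_submatrix, Matrix.transpose_transpose,
    ← Matrix.det_transpose (M.transpose.submatrix _ _), Matrix.transpose_submatrix,
    Matrix.transpose_transpose] at this

theorem boundedMinors_succ_le_sup_corner (M : Matrix (Fin m) (Fin n) S) (k : ℕ)
    (c : Fin m) (d : Fin n) :
    boundedMinors M (k + 1) (c + 1) (d + 1) ≤
      boundedMinors M (k + 1) c (d + 1) ⊔ boundedMinors M (k + 1) (c + 1) d ⊔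
        Ideal.span {x | ∃ (A : Fin k → Fin m) (B : Fin k → Fin n),
          (∀ l, (A l : ℕ) < c) ∧ (∀ l, (B l : ℕ) < d) ∧
          x = (M.submatrix (Fin.cons c A) (Fin.cons d B)).det} := by
  rw [boundedMinors_le_iff]
  intro f g hf hg
  by_cases hfi : Function.Injective f
  swap
  · rw [det_submatrix_eq_zero_of_not_injective _ _ hfi]; exact zero_mem _
  by_cases hgi : Function.Injective g
  swap
  · rw [det_submatrix_eq_zero_of_not_injective_right _ _ hgi]; exact zero_mem _
  by_cases h1 : ∃ l, f l = c
  swap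
  · refine Ideal.mem_sup_left (Ideal.mem_sup_left (det_mem_boundedMinors M (fun l => ?_) hg))
    have := hf l
    have h2 : (f l : ℕ) ≠ c := fun h => h1 ⟨l, Fin.ext h⟩
    omega
  by_cases h2 : ∃ l, g l = d
  swap
  · refine Ideal.mem_sup_left (Ideal.mem_sup_right (det_mem_boundedMinors M hf fun l => ?_))
    have := hg l
    have h3 : (g l : ℕ) ≠ d := fun h => h2 ⟨l, Fin.ext h⟩
    omega
  obtain ⟨l, rfl⟩ := h1
  obtain ⟨q, rfl⟩ := h2
  rw [exists_cons_row M f g l, exists_cons_col M _ g q]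
  refine Ideal.mul_mem_left _ _ (Ideal.mul_mem_left _ _ (Ideal.mem_sup_right
    (Ideal.subset_span ⟨_, _, fun p => ?_, fun p => ?_, rfl⟩)))
  · have h3 := hf (l.succAbove p)
    have h4 : (f (l.succAbove p) : ℕ) ≠ f l := fun h =>
      Fin.succAbove_ne l p (hfi (Fin.ext h))
    simp only [Function.comp]
    omega
  · have h3 := hg (q.succAbove p)
    have h4 : (g (q.succAbove p) : ℕ) ≠ g q := fun h =>
      Fin.succAbove_ne q p (hgi (Fin.ext h))
    simp only [Function.comp]
    omega

/-- If all `k × k` minors of `N` with rows satisfying `P` lie in `I`, so does each larger minor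
having at least `k` rows satisfying `P`. -/
theorem det_submatrix_mem_of_card {ι κ : Type*} (N : Matrix ι κ S) (P : ι → Prop)
    [DecidablePred P] {k : ℕ} {I : Ideal S}
    (h : ∀ (f : Fin k → ι) (g : Fin k → κ), (∀ l, P (f l)) → (N.submatrix f g).det ∈ I)
    {r : ℕ} (f : Fin r → ι) (g : Fin r → κ)
    (hk : k ≤ (Finset.univ.filter fun l => P (f l)).card) : (N.submatrix f g).det ∈ I := by
  induction r with
  | zero =>
    obtain rfl : k = 0 := by simpa using hk
    exact h f g fun l => l.elim0
  | succ r ih =>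
    by_cases hall : ∀ l, P (f l)
    · have hk' : k ≤ r + 1 := by simpa [hall] using hk
      rcases hk'.eq_or_lt with rfl | hlt
      · exact h f g hall
      · refine det_mem_of_expand _ 0 fun q => ?_
        rw [Matrix.submatrix_submatrix]
        refine ih _ _ ?_
        simp [hall]
        omega
    · push Not at hall
      obtain ⟨l, hl⟩ := hall
      refine det_mem_of_expand _ l fun q => ?_
      rw [Matrix.submatrix_submatrix]
      refine ih _ _ (hk.trans (le_of_eq ?_))
      rw [Fin.univ_succAbove _ l, Finset.filter_cons, if_neg hl, Finset.filter_map,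
        Finset.card_map]
      rfl

/-- Exchange relation between a minor `δ` bordered by a row `c` and a column `d`, and another one:
if the bordered minors not involving the corner vanish, then bordering is proportional. -/
theorem det_mul_bordered_det_eq {ι κ : Type*} (Y : Matrix ι κ S) {k : ℕ} (c : ι) (d : κ)
    (A C : Fin k → ι) (B D : Fin k → κ)
    (hCd : ∀ p, (Y.submatrix (Fin.cons (C p) A : Fin (k + 1) → ι)
      (Fin.cons d B : Fin (k + 1) → κ)).det = 0)
    (hCD : ∀ p q, (Y.submatrix (Fin.cons (C p) A : Fin (k + 1) → ι)
      (Fin.cons (D q) B : Fin (k + 1) → κ)).det = 0)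
    (hcD : ∀ q, (Y.submatrix (Fin.cons c A : Fin (k + 1) → ι)
      (Fin.cons (D q) B : Fin (k + 1) → κ)).det = 0)
    (hf : (Y.submatrix A B).det ∈ nonZeroDivisors S) :
    (Y.submatrix A B).det * (Y.submatrix (Fin.cons c C : Fin (k + 1) → ι)
      (Fin.cons d D : Fin (k + 1) → κ)).det =
    (Y.submatrix C D).det * (Y.submatrix (Fin.cons c A : Fin (k + 1) → ι)
      (Fin.cons d B : Fin (k + 1) → κ)).det := by
  set f := (Y.submatrix A B).det with hfdef
  let lam : Matrix (Fin k) (Fin k) S := Matrix.of fun p l => (-1) ^ (l : ℕ) *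
    (Y.submatrix ((Fin.cons (C p) A : Fin (k + 1) → ι) ∘ l.succ.succAbove) B).det
  let rho : Matrix (Fin k) (Fin k) S := Matrix.of fun l q => (-1) ^ (l : ℕ) *
    (Y.submatrix A ((Fin.cons (D q) B : Fin (k + 1) → κ) ∘ l.succ.succAbove)).det
  have hrow : ∀ p j, (Y.submatrix (Fin.cons (C p) A : Fin (k + 1) → ι)
      (Fin.cons j B : Fin (k + 1) → κ)).det = 0 →
      ∑ l, lam p l * Y (A l) j = f * Y (C p) j := by
    intro p j h0
    rw [Matrix.det_succ_column_zero, Fin.sum_univ_succ] at h0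
    simp only [Matrix.submatrix_apply, Matrix.submatrix_submatrix, Fin.cons_zero, Fin.cons_succ,
      Fin.val_zero, pow_zero, one_mul, Fin.val_succ] at h0
    have e1 : (Fin.cons (C p) A : Fin (k + 1) → ι) ∘ Fin.succAbove 0 = A := by ext; simp
    have e2 : (Fin.cons j B : Fin (k + 1) → κ) ∘ Fin.succ = B := by ext; simp
    rw [e1, e2, ← hfdef] at h0
    rw [mul_comm f, eq_neg_of_add_eq_zero_left h0, ← Finset.sum_neg_distrib]
    refine Finset.sum_congr rfl fun l _ => ?_
    simp only [lam, Matrix.of_apply]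
    ring
  have hcol : ∀ q i, (Y.submatrix (Fin.cons i A : Fin (k + 1) → ι)
      (Fin.cons (D q) B : Fin (k + 1) → κ)).det = 0 →
      ∑ l, Y i (B l) * rho l q = f * Y i (D q) := by
    intro q i h0
    rw [Matrix.det_succ_row_zero, Fin.sum_univ_succ] at h0
    simp only [Matrix.submatrix_apply, Matrix.submatrix_submatrix, Fin.cons_zero, Fin.cons_succ,
      Fin.val_zero, pow_zero, one_mul, Fin.val_succ] at h0
    have e1 : (Fin.cons (D q) B : Fin (k + 1) → κ) ∘ Fin.succAbove 0 = B := by ext; simp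
    have e2 : (Fin.cons i A : Fin (k + 1) → ι) ∘ Fin.succ = A := by ext; simp
    rw [e1, e2, ← hfdef] at h0
    rw [mul_comm f, eq_neg_of_add_eq_zero_left h0, ← Finset.sum_neg_distrib]
    refine Finset.sum_congr rfl fun l _ => ?_
    simp only [rho, Matrix.of_apply]
    ring
  have hAD : ∀ l q, (Y.submatrix (Fin.cons (A l) A : Fin (k + 1) → ι)
      (Fin.cons (D q) B : Fin (k + 1) → κ)).det = 0 := fun l q =>
    det_submatrix_eq_zero_of_not_injective _ _ fun h =>
      absurd (@h 0 l.succ (by simp)) (Fin.succ_ne_zero l).symm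
  let L : Matrix (Fin (k + 1)) (Fin (k + 1)) S :=
    Matrix.of (Fin.cons (Fin.cons f 0) fun p => Fin.cons 0 (lam p))
  let Rr : Matrix (Fin (k + 1)) (Fin (k + 1)) S :=
    Matrix.of (Fin.cons (Fin.cons f 0) fun p => Fin.cons 0 (rho p))
  have hL : L.det = f * lam.det := by
    rw [Matrix.det_succ_row_zero, Fin.sum_univ_succ]
    simp [L]
    rfl
  have hR : Rr.det = f * rho.det := by
    rw [Matrix.det_succ_row_zero, Fin.sum_univ_succ]
    simp [Rr]
    rfl
  have big1 : L * Y.submatrix (Fin.cons c A : Fin (k + 1) → ι) (Fin.cons d D : Fin (k + 1) → κ) =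
      f • Y.submatrix (Fin.cons c C : Fin (k + 1) → ι) (Fin.cons d D : Fin (k + 1) → κ) := by
    ext i j
    rw [Matrix.mul_apply, Fin.sum_univ_succ]
    refine Fin.cases ?_ (fun p => ?_) i
    · simp [L]
    · refine Fin.cases ?_ (fun q => ?_) j
      · simpa [L] using hrow p d (hCd p)
      · simpa [L] using hrow p (D q) (hCD p q)
  have big2 : Y.submatrix (Fin.cons c A : Fin (k + 1) → ι) (Fin.cons d B : Fin (k + 1) → κ) * Rr =
      f • Y.submatrix (Fin.cons c A : Fin (k + 1) → ι) (Fin.cons d D : Fin (k + 1) → κ) := by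
    ext i j
    rw [Matrix.mul_apply, Fin.sum_univ_succ]
    refine Fin.cases ?_ (fun q => ?_) j
    · simp [Rr, mul_comm]
    · refine Fin.cases ?_ (fun p => ?_) i
      · simpa [Rr] using hcol q c (hcD q)
      · simpa [Rr] using hcol q (A p) (hAD p q)
  have sm1 : lam * Y.submatrix A D = f • Y.submatrix C D := by
    ext p q
    simpa [Matrix.mul_apply] using hrow p (D q) (hCD p q)
  have sm2 : Y.submatrix A B * rho = f • Y.submatrix A D := by
    ext p q
    simpa [Matrix.mul_apply] using hcol q (A p) (hAD p q)
  have d1 := congrArg Matrix.det big1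
  have d2 := congrArg Matrix.det big2
  have d3 := congrArg Matrix.det sm1
  have d4 := congrArg Matrix.det sm2
  simp only [Matrix.det_mul, Matrix.det_smul, hL, hR, Fintype.card_fin] at d1 d2 d3 d4
  rw [← hfdef] at d4
  have hnz : f ^ (2 * k + 2) ∈ nonZeroDivisors S := pow_mem hf _
  refine (mul_cancel_left_mem_nonZeroDivisors hnz).1 ?_
  generalize (Y.submatrix (Fin.cons c C : Fin (k + 1) → ι) (Fin.cons d D : Fin (k + 1) → κ)).det
    = gCD at *
  generalize (Y.submatrix (Fin.cons c A : Fin (k + 1) → ι) (Fin.cons d B : Fin (k + 1) → κ)).det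
    = gAB at *
  generalize (Y.submatrix (Fin.cons c A : Fin (k + 1) → ι) (Fin.cons d D : Fin (k + 1) → κ)).det
    = gAD at *
  generalize (Y.submatrix C D).det = dCD at *
  generalize (Y.submatrix A D).det = dAD at *
  generalize lam.det = a at *
  generalize rho.det = b at *
  linear_combination (-f ^ (k + 2)) * d1 - f ^ 2 * a * d2 + f ^ (k + 2) * gAB * d3 +
    f ^ 2 * a * gAB * d4

end Minors

section Poly

open Polynomial

/-- `z` is a nonzerodivisor modulo the ideal `I`. -/
def NzdMod {S : Type*} [CommRing S] (I : Ideal S) (z : S) : Prop := ∀ u, z * u ∈ I → u ∈ I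

theorem nzdMod_iff {S : Type*} [CommRing S] {I : Ideal S} {z : S} :
    NzdMod I z ↔ Ideal.Quotient.mk I z ∈ nonZeroDivisors (S ⧸ I) := by
  rw [mem_nonZeroDivisors_iff_left]
  constructor
  · intro h y hy
    obtain ⟨y, rfl⟩ := Ideal.Quotient.mk_surjective y
    rw [← map_mul, Ideal.Quotient.eq_zero_iff_mem] at hy
    exact Ideal.Quotient.eq_zero_iff_mem.2 (h y hy)
  · intro h u hu
    rw [← Ideal.Quotient.eq_zero_iff_mem] at hu ⊢
    exact h _ (by rw [← map_mul, hu])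

theorem NzdMod.neg {S : Type*} [CommRing S] {I : Ideal S} {z : S} (h : NzdMod I z) :
    NzdMod I (-z) := fun u hu => h u (by simpa using neg_mem hu)

theorem NzdMod.neg_one_pow_mul {S : Type*} [CommRing S] {I : Ideal S} {z : S} (h : NzdMod I z)
    (k : ℕ) : NzdMod I ((-1) ^ k * z) := by
  rcases neg_one_pow_eq_or S k with hk | hk <;> rw [hk]
  · simpa using h
  · simpa using h.neg

theorem nzdMod_top {S : Type*} [CommRing S] (z : S) : NzdMod (⊤ : Ideal S) z :=
  fun _ _ => Submodule.mem_top

variable {Q : Type*} [CommRing Q] {f ε : Q} {J : Ideal Q}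

/-- A polynomial whose `f`-multiple is a multiple `(f Y + ε) j`, with `j ∈ J[Y]`, has leading
coefficient in `J`, and is zero when constant. -/
theorem coeff_mem_of_mul_eq_linear_mul (hf : f ∈ nonZeroDivisors Q) {u j : Q[X]}
    (hj : j ∈ J.map C) (h : C f * u = (C f * X + C ε) * j) :
    u.coeff u.natDegree ∈ J ∧ (u.natDegree = 0 → u = 0) := by
  have hcoeff : ∀ N, f * u.coeff (N + 1) = f * j.coeff N + ε * j.coeff (N + 1) := by
    intro N
    have := congrArg (fun p => p.coeff (N + 1)) h
    simpa [add_mul, mul_assoc, coeff_X_mul] using this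
  have hcancel : ∀ a b, f * a = f * b → a = b := fun a b hab =>
    (mul_cancel_left_mem_nonZeroDivisors hf).1 hab
  have hdeg : ∀ N, u.natDegree ≤ N → j.coeff N = 0 := by
    have key : ∀ e N, j.natDegree + 1 ≤ N + e → u.natDegree ≤ N → j.coeff N = 0 := by
      intro e
      induction e with
      | zero =>
        intro N h1 _
        exact coeff_eq_zero_of_natDegree_lt (by omega)
      | succ e ih =>
        intro N h1 h2
        have h3 := ih (N + 1) (by omega) (by omega)
        have h4 := hcoeff N
        rw [h3, coeff_eq_zero_of_natDegree_lt (show u.natDegree < N + 1 by omega)] at h4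
        exact hcancel _ _ (by simpa using h4.symm)
    exact fun N hN => key (j.natDegree + 1) N (by omega) hN
  have hzero : u.natDegree = 0 → u = 0 := by
    intro h0
    have hj0 : j = 0 := by
      ext N
      exact hdeg N (by omega)
    ext N
    apply hcancel
    have := congrArg (fun p => p.coeff N) h
    simpa [hj0] using this
  refine ⟨?_, hzero⟩
  rcases Nat.eq_zero_or_pos u.natDegree with h0 | hpos
  · rw [hzero h0]; simp
  · obtain ⟨N, hN⟩ : ∃ N, u.natDegree = N + 1 := ⟨u.natDegree - 1, by omega⟩
    have h4 := hcoeff N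
    rw [hdeg (N + 1) (by omega)] at h4
    rw [hN, hcancel (u.coeff (N + 1)) (j.coeff N) (by simpa using h4)]
    exact Ideal.mem_map_C_iff.1 hj N

theorem mem_of_C_mul_mem_of_mul_eq_linear_mul (hf : f ∈ nonZeroDivisors Q)
    (hJ : ∀ q ∈ J, ∃ r, f * r = ε * q) {T : Ideal Q[X]}
    (hT : ∀ u, u ∈ T ↔ ∃ j ∈ J.map C, C f * u = (C f * X + C ε) * j)
    {z y : Q} (hz : z ∈ nonZeroDivisors Q) (hy : NzdMod J y)
    (hzy : ∀ u, C z * u ∈ T → C y * u ∈ T) (u : Q[X]) (hu : C z * u ∈ T) : u ∈ T := by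
  have key : ∀ e (u : Q[X]), u.natDegree ≤ e → C z * u ∈ T → u ∈ T := by
    intro e
    induction e with
    | zero =>
      intro u hd hu
      obtain ⟨j, hj, hju⟩ := (hT _).1 hu
      have h0 : (C z * u).natDegree = 0 := by
        have := natDegree_C_mul_le z u
        omega
      have h1 := (coeff_mem_of_mul_eq_linear_mul hf hj hju).2 h0
      have h2 : u = 0 := by
        ext N
        refine mem_nonZeroDivisors_iff_left.1 hz _ ?_
        have := congrArg (fun p => p.coeff N) h1
        simpa using this
      rw [h2]; exact zero_mem _
    | succ e ih =>
      intro u hd hu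
      have hlead : u.coeff (e + 1) ∈ J := by
        apply hy
        obtain ⟨j, hj, hju⟩ := (hT _).1 (hzy u hu)
        have h1 := (coeff_mem_of_mul_eq_linear_mul hf hj hju).1
        by_cases h2 : (C y * u).natDegree = e + 1
        · rw [h2] at h1
          simpa using h1
        · have h3 := natDegree_C_mul_le y u
          have h4 : (C y * u).coeff (e + 1) = 0 :=
            coeff_eq_zero_of_natDegree_lt (by omega)
          rw [coeff_C_mul] at h4
          rw [h4]; exact zero_mem _
      obtain ⟨r, hr⟩ := hJ _ hlead
      have hsub : X ^ e * (C (u.coeff (e + 1)) * X + C r) ∈ T := by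
        refine T.mul_mem_left _ ((hT _).2 ⟨C (u.coeff (e + 1)), Ideal.mem_map_of_mem _ hlead, ?_⟩)
        have : C f * C r = C ε * C (u.coeff (e + 1)) := by rw [← C_mul, hr, C_mul]
        linear_combination this
      have := ih (u - X ^ e * (C (u.coeff (e + 1)) * X + C r)) ?_ ?_
      · simpa using add_mem this hsub
      · rw [natDegree_le_iff_coeff_eq_zero]
        intro N hN
        rw [coeff_sub, mul_add, coeff_add, ← mul_assoc, mul_comm (X ^ e) (C _), mul_assoc,
          ← pow_succ, coeff_C_mul_X_pow, mul_comm, coeff_C_mul_X_pow]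
        by_cases h1 : N = e + 1
        · subst h1
          simp
        · rw [if_neg h1, if_neg (by omega), coeff_eq_zero_of_natDegree_lt (by omega)]
          simp
      · rw [mul_sub]
        exact sub_mem hu (T.mul_mem_left _ hsub)
  exact key u.natDegree u le_rfl hu

end Poly

section Corner

open Polynomial

variable {S : Type*} [CommRing S] {W : Ideal S}

/-- A proportionality relation `f g = δ g₀` between two families turns them into isomorphic
ideals modulo `W`. -/
theorem mem_sup_span_range_iff {ι : Type*} {δ g : ι → S} {i₀ : ι} (hf : NzdMod W (δ i₀))
    (hrel : ∀ i, δ i₀ * g i - δ i * g i₀ ∈ W) (h : S) :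
    h ∈ W ⊔ Ideal.span (Set.range g) ↔
      ∃ j ∈ W ⊔ Ideal.span (Set.range δ), δ i₀ * h - g i₀ * j ∈ W := by
  constructor
  · intro hh
    obtain ⟨w, hw, b, hb, rfl⟩ := Submodule.mem_sup.1 hh
    obtain ⟨j, hj, hbj⟩ : ∃ j ∈ Ideal.span (Set.range δ), δ i₀ * b - g i₀ * j ∈ W := by
      clear hh hw
      induction hb using Submodule.span_induction with
      | mem x hx =>
        obtain ⟨i, rfl⟩ := hx
        exact ⟨δ i, Ideal.subset_span ⟨i, rfl⟩, by rw [mul_comm (g i₀)]; exact hrel i⟩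
      | zero => exact ⟨0, zero_mem _, by simp⟩
      | add x y _ _ hx hy =>
        obtain ⟨j, hj, h1⟩ := hx
        obtain ⟨j', hj', h2⟩ := hy
        refine ⟨j + j', add_mem hj hj', ?_⟩
        convert add_mem h1 h2 using 1
        ring
      | smul a x _ hx =>
        obtain ⟨j, hj, h1⟩ := hx
        refine ⟨a * j, Ideal.mul_mem_left _ _ hj, ?_⟩
        convert W.mul_mem_left a h1 using 1
        simp only [smul_eq_mul]
        ring
    refine ⟨j, Ideal.mem_sup_right hj, ?_⟩
    convert add_mem (W.mul_mem_left (δ i₀) hw) hbj using 1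
    ring
  · rintro ⟨j, hj, h1⟩
    obtain ⟨w, hw, b, hb, rfl⟩ := Submodule.mem_sup.1 hj
    obtain ⟨a, ha, h2⟩ : ∃ a ∈ Ideal.span (Set.range g), δ i₀ * a - g i₀ * b ∈ W := by
      clear hj hw h1
      induction hb using Submodule.span_induction with
      | mem x hx =>
        obtain ⟨i, rfl⟩ := hx
        exact ⟨g i, Ideal.subset_span ⟨i, rfl⟩, by rw [mul_comm (g i₀)]; exact hrel i⟩
      | zero => exact ⟨0, zero_mem _, by simp⟩
      | add x y _ _ hx hy =>
        obtain ⟨j, hj, h1⟩ := hx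
        obtain ⟨j', hj', h2⟩ := hy
        refine ⟨j + j', add_mem hj hj', ?_⟩
        convert add_mem h1 h2 using 1
        ring
      | smul a x _ hx =>
        obtain ⟨j, hj, h1⟩ := hx
        refine ⟨a * j, Ideal.mul_mem_left _ _ hj, ?_⟩
        convert W.mul_mem_left a h1 using 1
        simp only [smul_eq_mul]
        ring
    have h3 : h - a ∈ W := by
      apply hf
      convert sub_mem (add_mem h1 (W.mul_mem_left (g i₀) hw)) h2 using 1
      ring
    have := add_mem (Ideal.mem_sup_left (T := Ideal.span (Set.range g)) h3)
      (Ideal.mem_sup_right (S := W) ha)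
    simpa using this

/-- `φ` exhibits `x` as a polynomial variable over a quotient `S ⧸ W`. -/
structure IsVarMod (W : Ideal S) (x : S) (φ : S →+* (S ⧸ W)[X]) : Prop where
  map_ideal : ∀ p ∈ W, φ p = 0
  map_var : φ x = X
  eval_map : ∀ p, (φ p).eval (Ideal.Quotient.mk W x) = Ideal.Quotient.mk W p

theorem IsVarMod.nzdMod_linear {x : S} {φ : S →+* (S ⧸ W)[X]} (hφ : IsVarMod W x φ) {a b : S}
    (ha : φ a = C (Ideal.Quotient.mk W a)) (hb : φ b = C (Ideal.Quotient.mk W b))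
    (hnz : NzdMod W a) : NzdMod W (x * a + b) := by
  intro u hu
  have h1 := hφ.map_ideal _ hu
  rw [map_mul, map_add, map_mul, hφ.map_var, ha, hb] at h1
  have h2 : (X * C (Ideal.Quotient.mk W a) + C (Ideal.Quotient.mk W b) : (S ⧸ W)[X]) ∈
      nonZeroDivisors (S ⧸ W)[X] := by
    refine mem_nonzeroDivisors_of_coeff_mem 1 ?_
    simpa [coeff_C] using nzdMod_iff.1 hnz
  have h3 : φ u = 0 := mem_nonZeroDivisors_iff_left.1 h2 _ h1
  rw [← Ideal.Quotient.eq_zero_iff_mem, ← hφ.eval_map, h3, eval_zero]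

theorem IsVarMod.nzdMod_sup_span {x : S} {φ : S →+* (S ⧸ W)[X]} (hφ : IsVarMod W x φ)
    {ι : Type*} {δ ε g : ι → S} {i₀ : ι} (hg : ∀ i, g i = x * δ i + ε i)
    (hδ : ∀ i, φ (δ i) = C (Ideal.Quotient.mk W (δ i)))
    (hε : ∀ i, φ (ε i) = C (Ideal.Quotient.mk W (ε i)))
    (hf : NzdMod W (δ i₀)) (hrel : ∀ i, δ i₀ * g i - δ i * g i₀ ∈ W) {z y : S}
    (hz : φ z = C (Ideal.Quotient.mk W z)) (hy : φ y = C (Ideal.Quotient.mk W y))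
    (hzW : NzdMod W z) (hyV : NzdMod (W ⊔ Ideal.span (Set.range δ)) y)
    (hzy : y = z ∨ x * z + y ∈ W ⊔ Ideal.span (Set.range g)) :
    NzdMod (W ⊔ Ideal.span (Set.range g)) z := by
  set π := Ideal.Quotient.mk W with hπ
  set J : Ideal (S ⧸ W) := Ideal.span (Set.range fun i => π (δ i)) with hJdef
  have hJmem : ∀ j, j ∈ W ⊔ Ideal.span (Set.range δ) ↔ π j ∈ J := by
    intro j
    have : J = (W ⊔ Ideal.span (Set.range δ)).map π := by
      rw [Ideal.map_sup, Ideal.map_span, ← Set.range_comp, hπ, Ideal.map_quotient_self, bot_sup_eq]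
      rfl
    rw [this, hπ, ← Ideal.mem_comap, Ideal.comap_map_of_surjective' _ Ideal.Quotient.mk_surjective,
      Ideal.mk_ker, sup_comm _ W, ← sup_assoc, sup_idem]
  have hf' : π (δ i₀) ∈ nonZeroDivisors (S ⧸ W) := nzdMod_iff.1 hf
  have hrelW : ∀ i, π (δ i₀) * π (ε i) = π (ε i₀) * π (δ i) := by
    intro i
    have h := hrel i
    rw [hg, hg, ← Ideal.Quotient.eq_zero_iff_mem] at h
    rw [← sub_eq_zero, ← map_mul, ← map_mul, ← map_sub, hπ, ← h]
    congr 1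
    ring
  have hJdiv : ∀ q ∈ J, ∃ r, π (δ i₀) * r = π (ε i₀) * q := by
    intro q hq
    induction hq using Submodule.span_induction with
    | mem _ hx =>
      obtain ⟨i, rfl⟩ := hx
      exact ⟨_, hrelW i⟩
    | zero => exact ⟨0, by simp⟩
    | add _ _ _ _ hx hy =>
      obtain ⟨r, hr⟩ := hx
      obtain ⟨s, hs⟩ := hy
      exact ⟨r + s, by rw [mul_add, hr, hs, mul_add]⟩
    | smul a _ _ hx =>
      obtain ⟨r, hr⟩ := hx
      exact ⟨a * r, by rw [smul_eq_mul]; linear_combination a * hr⟩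
  let T : Ideal (S ⧸ W)[X] :=
    { carrier := {u | ∃ j ∈ J.map C, C (π (δ i₀)) * u = (C (π (δ i₀)) * X + C (π (ε i₀))) * j}
      add_mem' := by
        rintro a b ⟨j, hj, h1⟩ ⟨j', hj', h2⟩
        exact ⟨j + j', add_mem hj hj', by rw [mul_add, h1, h2, mul_add]⟩
      zero_mem' := ⟨0, zero_mem _, by simp⟩
      smul_mem' := by
        rintro a b ⟨j, hj, h1⟩
        exact ⟨a * j, Ideal.mul_mem_left _ _ hj, by
          rw [smul_eq_mul]; linear_combination a * h1⟩ }
  have hT : ∀ u, u ∈ T ↔ ∃ j ∈ J.map C,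
      C (π (δ i₀)) * u = (C (π (δ i₀)) * X + C (π (ε i₀))) * j := fun u => Iff.rfl
  have hVT : ∀ h ∈ W ⊔ Ideal.span (Set.range g), φ h ∈ T := by
    intro h hh
    have hle : W ⊔ Ideal.span (Set.range g) ≤ T.comap φ := by
      refine sup_le (fun w hw => ?_) (Ideal.span_le.2 ?_)
      · rw [Ideal.mem_comap, hφ.map_ideal w hw]; exact zero_mem _
      · rintro _ ⟨i, rfl⟩
        refine ⟨C (π (δ i)), Ideal.mem_map_of_mem _ (Ideal.subset_span ⟨i, rfl⟩), ?_⟩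
        rw [hg, map_add, map_mul, hφ.map_var, hδ, hε]
        have : C (π (δ i₀)) * C (π (ε i)) = C (π (ε i₀)) * C (π (δ i)) := by
          rw [← C_mul, hrelW, C_mul]
        linear_combination this
    exact hle hh
  have hTV : ∀ h, φ h ∈ T → h ∈ W ⊔ Ideal.span (Set.range g) := by
    rintro h ⟨j, hj, h1⟩
    have h2 := congrArg (eval (π x)) h1
    have h3 : eval (π x) j ∈ J := by
      have : J.map C ≤ J.comap (evalRingHom (π x)) := by
        rw [Ideal.map_le_iff_le_comap]
        intro q hq
        simpa using hq
      exact this hj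
    rw [eval_mul, eval_mul, hφ.eval_map, eval_C, eval_add, eval_mul, eval_C, eval_X, eval_C] at h2
    obtain ⟨j', hj'⟩ := Ideal.Quotient.mk_surjective (eval (π x) j)
    rw [← hj'] at h2 h3
    refine (mem_sup_span_range_iff hf hrel h).2 ⟨j', (hJmem _).2 h3, ?_⟩
    rw [← Ideal.Quotient.eq_zero_iff_mem, hg]
    simp only [map_sub, map_mul, map_add]
    rw [h2]
    ring
  intro u hu
  apply hTV
  refine mem_of_C_mul_mem_of_mul_eq_linear_mul (z := π z) (y := π y) hf' hJdiv hT
    (nzdMod_iff.1 hzW) ?_ ?_ _ ?_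
  · intro q hq
    obtain ⟨q, rfl⟩ := Ideal.Quotient.mk_surjective q
    rw [← hπ, ← map_mul, ← hJmem] at hq
    exact (hJmem _).1 (hyV _ hq)
  · intro v hv
    rcases hzy with rfl | hzy
    · exact hv
    · have h1 := hVT _ hzy
      rw [map_add, map_mul, hφ.map_var, hz, hy] at h1
      have h2 := sub_mem (T.mul_mem_right v h1) (T.mul_mem_left X hv)
      convert h2 using 1
      ring
  · rw [← hz, ← map_mul]
    exact hVT _ hu

end Corner

section FreeVariable

open Polynomial

variable {σ R : Type*} [CommRing R] [DecidableEq σ]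

/-- Replace the variable `v` by the polynomial variable. -/
noncomputable def splitVar (R : Type*) [CommRing R] (v : σ) :
    MvPolynomial σ R →+* (MvPolynomial σ R)[X] :=
  (MvPolynomial.aeval (R := R) fun w =>
    if w = v then (X : (MvPolynomial σ R)[X]) else C (MvPolynomial.X w)).toRingHom

/-- The polynomials that do not involve the variable `v`. -/
noncomputable def freeOf (R : Type*) [CommRing R] (v : σ) : Subring (MvPolynomial σ R) :=
  RingHom.eqLocus (splitVar R v) C

theorem splitVar_X_self (v : σ) : splitVar R v (MvPolynomial.X v) = X := by
  simp [splitVar]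

theorem X_mem_freeOf {v w : σ} (h : w ≠ v) : MvPolynomial.X w ∈ freeOf R v := by
  show splitVar R v _ = _
  simp [splitVar, h]

theorem eval_splitVar (v : σ) (p : MvPolynomial σ R) :
    (splitVar R v p).eval (MvPolynomial.X v) = p := by
  have : ((evalRingHom (MvPolynomial.X v)).comp (splitVar R v)) =
      RingHom.id (MvPolynomial σ R) := by
    apply MvPolynomial.ringHom_ext
    · intro r
      simp [splitVar, Polynomial.algebraMap_apply, MvPolynomial.algebraMap_eq]
    · intro w
      by_cases h : w = v <;> simp [splitVar, h]
  exact congrArg (fun φ => φ p) this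

/-- An ideal generated by polynomials that do not involve the variable `v`. -/
def IdealFreeOf (v : σ) (I : Ideal (MvPolynomial σ R)) : Prop :=
  I.map (splitVar R v) ≤ I.map C

theorem IdealFreeOf.sup {v : σ} {I J : Ideal (MvPolynomial σ R)} (hI : IdealFreeOf v I)
    (hJ : IdealFreeOf v J) : IdealFreeOf v (I ⊔ J) := by
  unfold IdealFreeOf at *
  rw [Ideal.map_sup, Ideal.map_sup]
  exact sup_le_sup hI hJ

theorem IdealFreeOf.iSup {ι : Sort*} {v : σ} {I : ι → Ideal (MvPolynomial σ R)}
    (hI : ∀ i, IdealFreeOf v (I i)) : IdealFreeOf v (⨆ i, I i) := by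
  unfold IdealFreeOf at *
  rw [Ideal.map_iSup, Ideal.map_iSup]
  exact iSup_mono hI

theorem idealFreeOf_span {v : σ} {s : Set (MvPolynomial σ R)} (hs : ∀ p ∈ s, p ∈ freeOf R v) :
    IdealFreeOf v (Ideal.span s) := by
  unfold IdealFreeOf
  rw [Ideal.map_span, Ideal.span_le]
  rintro _ ⟨p, hp, rfl⟩
  rw [show splitVar R v p = C p from hs p hp]
  exact Ideal.mem_map_of_mem _ (Ideal.subset_span hp)

theorem idealFreeOf_bot (v : σ) : IdealFreeOf v (⊥ : Ideal (MvPolynomial σ R)) := by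
  unfold IdealFreeOf
  rw [Ideal.map_bot]; exact bot_le

/-- `splitVar` modulo an ideal. -/
noncomputable def splitVarMod (v : σ) (W : Ideal (MvPolynomial σ R)) :
    MvPolynomial σ R →+* (MvPolynomial σ R ⧸ W)[X] :=
  (mapRingHom (Ideal.Quotient.mk W)).comp (splitVar R v)

theorem splitVarMod_of_mem_freeOf {v : σ} (W : Ideal (MvPolynomial σ R)) {p : MvPolynomial σ R}
    (hp : p ∈ freeOf R v) : splitVarMod v W p = C (Ideal.Quotient.mk W p) := by
  rw [splitVarMod, RingHom.comp_apply, show splitVar R v p = C p from hp]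
  simp

theorem isVarMod_splitVarMod {v : σ} {W : Ideal (MvPolynomial σ R)} (hW : IdealFreeOf v W) :
    IsVarMod W (MvPolynomial.X v) (splitVarMod v W) where
  map_ideal p hp := by
    have h1 := hW (Ideal.mem_map_of_mem _ hp)
    rw [splitVarMod, RingHom.comp_apply, coe_mapRingHom]
    ext i
    rw [coeff_map, coeff_zero, Ideal.Quotient.eq_zero_iff_mem]
    exact Ideal.mem_map_C_iff.1 h1 i
  map_var := by
    rw [splitVarMod, RingHom.comp_apply, splitVar_X_self]; simp
  eval_map p := by
    rw [splitVarMod, RingHom.comp_apply, coe_mapRingHom, eval_map_apply, eval_splitVar]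

theorem nzdMod_of_free {v : σ} {W : Ideal (MvPolynomial σ R)} (hW : IdealFreeOf v W)
    {a b : MvPolynomial σ R} (ha : a ∈ freeOf R v) (hb : b ∈ freeOf R v) (hnz : NzdMod W a) :
    NzdMod W (MvPolynomial.X v * a + b) :=
  (isVarMod_splitVarMod hW).nzdMod_linear (splitVarMod_of_mem_freeOf W ha)
    (splitVarMod_of_mem_freeOf W hb) hnz

end FreeVariable

section DetLemmas

theorem boundedMinors_antitone {S : Type*} [CommRing S] {m n : ℕ} (M : Matrix (Fin m) (Fin n) S)
    {k k' : ℕ} (h : k ≤ k') (i j : ℕ) : boundedMinors M k' i j ≤ boundedMinors M k i j := by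
  induction k', h using Nat.le_induction with
  | base => exact le_rfl
  | succ k' _ ih =>
    exact ((boundedMinors_mono M _ (Nat.le_succ i) le_rfl).trans
      (boundedMinors_succ_row_le M k' i j)).trans ih

theorem det_mem_subring {S : Type*} [CommRing S] (T : Subring S) {r : ℕ}
    (N : Matrix (Fin r) (Fin r) S) (h : ∀ i j, N i j ∈ T) : N.det ∈ T := by
  rw [Matrix.det_apply]
  refine sum_mem fun σ _ => ?_
  rw [Units.smul_def]
  exact zsmul_mem (prod_mem fun i _ => h _ _) _

theorem det_eq_entry_mul_add {S : Type*} [CommRing S] {r : ℕ}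
    (N : Matrix (Fin (r + 1)) (Fin (r + 1)) S) (l q : Fin (r + 1)) :
    N.det = N l q * ((-1) ^ (l + q : ℕ) * (N.submatrix l.succAbove q.succAbove).det) +
      (N.updateRow l (Function.update (N l) q 0)).det := by
  have hsub : ∀ j : Fin (r + 1), (N.updateRow l (Function.update (N l) q 0)).submatrix
      l.succAbove j.succAbove = N.submatrix l.succAbove j.succAbove := by
    intro j
    ext a b
    simp
  rw [Matrix.det_succ_row _ l, Matrix.det_succ_row _ l, Fin.sum_univ_succAbove _ q,
    Fin.sum_univ_succAbove _ q]
  simp only [hsub, Matrix.updateRow_self, Function.update_self,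
    Function.update_of_ne (Fin.succAbove_ne q _)]
  ring

variable {σ R : Type*} [CommRing R] [DecidableEq σ]

theorem det_updateRow_mem_freeOf {v : σ} {r : ℕ}
    (N : Matrix (Fin (r + 1)) (Fin (r + 1)) (MvPolynomial σ R)) (l q : Fin (r + 1))
    (hfree : ∀ l' q', (l', q') ≠ (l, q) → N l' q' ∈ freeOf R v) :
    (N.updateRow l (Function.update (N l) q 0)).det ∈ freeOf R v := by
  refine det_mem_subring _ _ fun i j => ?_
  by_cases hi : i = l
  · subst hi
    rw [Matrix.updateRow_self]
    by_cases hj : j = q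
    · subst hj
      rw [Function.update_self]; exact zero_mem _
    · rw [Function.update_of_ne hj]
      exact hfree _ _ (by simp [hj])
  · rw [Matrix.updateRow_ne hi]
    exact hfree _ _ (by simp [hi])

theorem nzdMod_det_of_free {v : σ} {W : Ideal (MvPolynomial σ R)} (hW : IdealFreeOf v W) {r : ℕ}
    (N : Matrix (Fin (r + 1)) (Fin (r + 1)) (MvPolynomial σ R)) (l q : Fin (r + 1))
    (hlq : N l q = MvPolynomial.X v)
    (hfree : ∀ l' q', (l', q') ≠ (l, q) → N l' q' ∈ freeOf R v)
    (hnz : NzdMod W (N.submatrix l.succAbove q.succAbove).det) : NzdMod W N.det := by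
  rw [det_eq_entry_mul_add N l q, hlq]
  refine nzdMod_of_free hW (mul_mem (pow_mem (neg_mem (one_mem _)) _)
    (det_mem_subring _ _ fun i j => hfree _ _ ?_)) (det_updateRow_mem_freeOf N l q hfree)
    (hnz.neg_one_pow_mul _)
  simp [Fin.succAbove_ne l i]

end DetLemmas

section Ladder

variable (R : Type*) [CommRing R] (m n : ℕ)

/-- Minors of the generic matrix with sizes bounded below by `t` in the first rows: those in the
first `d` columns, and those in the first `d + 1` columns and at most `c` rows. -/
noncomputable def ladderIdeal (t : ℕ → ℕ) (d c : ℕ) : Ideal (MvPolynomial (Fin m × Fin n) R) :=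
  (⨆ i, ⨆ _ : i ≤ m, boundedMinors (Matrix.mvPolynomialX (Fin m) (Fin n) R) (t i) i d) ⊔
    ⨆ i, ⨆ _ : i ≤ c, boundedMinors (Matrix.mvPolynomialX (Fin m) (Fin n) R) (t i) i (d + 1)

/-- Monotone sequences with steps at most one. -/
def SlowMono (t : ℕ → ℕ) : Prop := ∀ i, t i ≤ t (i + 1) ∧ t (i + 1) ≤ t i + 1

variable {R m n} {t : ℕ → ℕ} {d c : ℕ}

theorem SlowMono.monotone (ht : SlowMono t) : Monotone t :=
  monotone_nat_of_le_succ fun i => (ht i).1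

theorem SlowMono.le_add (ht : SlowMono t) (i j : ℕ) : t (i + j) ≤ t i + j := by
  induction j with
  | zero => simp
  | succ j ih =>
    have := (ht (i + j)).2
    rw [← add_assoc]; omega

theorem ladderIdeal_le_iff {I : Ideal (MvPolynomial (Fin m × Fin n) R)} :
    ladderIdeal R m n t d c ≤ I ↔
      (∀ i ≤ m, boundedMinors (Matrix.mvPolynomialX (Fin m) (Fin n) R) (t i) i d ≤ I) ∧
      ∀ i ≤ c, boundedMinors (Matrix.mvPolynomialX (Fin m) (Fin n) R) (t i) i (d + 1) ≤ I := by
  simp only [ladderIdeal, sup_le_iff, iSup_le_iff]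

theorem boundedMinors_le_ladderIdeal {i : ℕ} (hi : i ≤ m) :
    boundedMinors (Matrix.mvPolynomialX (Fin m) (Fin n) R) (t i) i d ≤ ladderIdeal R m n t d c :=
  (ladderIdeal_le_iff.1 le_rfl).1 i hi

theorem boundedMinors_succ_le_ladderIdeal {i : ℕ} (hi : i ≤ c) :
    boundedMinors (Matrix.mvPolynomialX (Fin m) (Fin n) R) (t i) i (d + 1) ≤
      ladderIdeal R m n t d c :=
  have h : ladderIdeal R m n t d c ≤ ladderIdeal R m n t d c := le_rfl
  (ladderIdeal_le_iff.1 h).2 i hi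

theorem ladderIdeal_eq_top (h : t 0 = 0) : ladderIdeal R m n t d c = ⊤ := by
  have := boundedMinors_le_ladderIdeal (R := R) (n := n) (t := t) (d := d) (c := c) (Nat.zero_le m)
  rwa [h, boundedMinors_zero, top_le_iff] at this

theorem ladderIdeal_zero_zero (ht : ∀ i ≤ m, 1 ≤ t i) : ladderIdeal R m n t 0 0 = ⊥ := by
  rw [eq_bot_iff, ladderIdeal_le_iff]
  constructor
  · intro i hi
    rw [boundedMinors_eq_bot_of_col_lt _ _ (ht i hi)]
  · intro i hi
    obtain rfl : i = 0 := by omega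
    rw [boundedMinors_eq_bot_of_row_lt _ _ (ht 0 (Nat.zero_le _))]

theorem ladderIdeal_succ_zero (ht : 1 ≤ t 0) :
    ladderIdeal R m n t (d + 1) 0 = ladderIdeal R m n t d m := by
  apply le_antisymm <;> rw [ladderIdeal_le_iff]
  · constructor
    · intro i hi
      exact boundedMinors_succ_le_ladderIdeal hi
    · intro i hi
      obtain rfl : i = 0 := by omega
      rw [boundedMinors_eq_bot_of_row_lt _ _ ht]; exact bot_le
  · exact ⟨fun i hi => (boundedMinors_mono _ _ le_rfl (Nat.le_succ d)).trans
      (boundedMinors_le_ladderIdeal hi), fun i hi => boundedMinors_le_ladderIdeal hi⟩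

theorem ladderIdeal_succ :
    ladderIdeal R m n t d (c + 1) = ladderIdeal R m n t d c ⊔
      boundedMinors (Matrix.mvPolynomialX (Fin m) (Fin n) R) (t (c + 1)) (c + 1) (d + 1) := by
  apply le_antisymm
  · rw [ladderIdeal_le_iff]
    refine ⟨fun i hi => le_sup_of_le_left (boundedMinors_le_ladderIdeal hi), fun i hi => ?_⟩
    rcases Nat.lt_or_ge i (c + 1) with h | h
    · exact le_sup_of_le_left (boundedMinors_succ_le_ladderIdeal (by omega))
    · obtain rfl : i = c + 1 := by omega
      exact le_sup_right
  · refine sup_le ?_ (boundedMinors_succ_le_ladderIdeal le_rfl)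
    rw [ladderIdeal_le_iff]
    exact ⟨fun i hi => boundedMinors_le_ladderIdeal hi,
      fun i hi => boundedMinors_succ_le_ladderIdeal (by omega)⟩

theorem ladderIdeal_succ_of_step (h : t (c + 1) = t c + 1) :
    ladderIdeal R m n t d (c + 1) = ladderIdeal R m n t d c := by
  rw [ladderIdeal_succ, sup_eq_left, h]
  exact (boundedMinors_succ_row_le _ _ _ _).trans (boundedMinors_succ_le_ladderIdeal le_rfl)

theorem ladderIdeal_succ_of_lt (h : c + 1 < t (c + 1) ∨ d + 1 < t (c + 1)) :
    ladderIdeal R m n t d (c + 1) = ladderIdeal R m n t d c := by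
  rw [ladderIdeal_succ, sup_eq_left]
  rcases h with h | h
  · rw [boundedMinors_eq_bot_of_row_lt _ _ h]; exact bot_le
  · rw [boundedMinors_eq_bot_of_col_lt _ _ h]; exact bot_le

theorem idealFreeOf_boundedMinors {v : Fin m × Fin n} {k i j : ℕ}
    (hv : i ≤ v.1 ∨ j ≤ v.2) :
    IdealFreeOf v (boundedMinors (Matrix.mvPolynomialX (Fin m) (Fin n) R) k i j) := by
  refine idealFreeOf_span ?_
  rintro _ ⟨f, g, hf, hg, rfl⟩
  refine det_mem_subring _ _ fun a b => X_mem_freeOf ?_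
  rintro rfl
  have := hf a
  have := hg b
  simp only at hv
  omega

theorem idealFreeOf_ladderIdeal {v : Fin m × Fin n} (hc : c ≤ v.1) (hd : d ≤ v.2) :
    IdealFreeOf v (ladderIdeal R m n t d c) :=
  IdealFreeOf.sup (.iSup fun _ => .iSup fun _ => idealFreeOf_boundedMinors (.inr hd))
    (.iSup fun _ => .iSup fun hi => idealFreeOf_boundedMinors (.inl (hi.trans hc)))

/-- Lower the size bound to `k` in the rows up to `c`. -/
def lowerBound (t : ℕ → ℕ) (c k : ℕ) : ℕ → ℕ := fun i => if i ≤ c then min (t i) k else t i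

theorem slowMono_lowerBound {k : ℕ} (ht : SlowMono t) (hk : t c = k + 1)
    (hk1 : t (c + 1) = k + 1) : SlowMono (lowerBound t c k) := by
  intro i
  have h := ht i
  simp only [lowerBound, min_def]
  rcases eq_or_ne i c with rfl | hi
  · split_ifs <;> omega
  · split_ifs <;> omega

theorem exists_last_le (t : ℕ → ℕ) (c k : ℕ) (ht : SlowMono t) (hk : t c = k + 1) :
    ∃ i₀ ≤ c, (i₀ = 0 ∨ t i₀ ≤ k) ∧ ∀ i, i₀ < i → i ≤ c → t i = k + 1 := by
  classical
  refine ⟨Nat.findGreatest (fun i => t i ≤ k) c, Nat.findGreatest_le _, ?_, ?_⟩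
  · by_cases h : Nat.findGreatest (fun i => t i ≤ k) c = 0
    · exact .inl h
    · exact .inr (Nat.findGreatest_of_ne_zero (P := fun i => t i ≤ k) rfl h)
  · intro i h1 h2
    have h3 := Nat.findGreatest_is_greatest h1 h2
    have h4 := ht.monotone h2
    omega

theorem ladderIdeal_lowerBound {k i₀ : ℕ} (ht : SlowMono t) (hc : c ≤ m) (hk : t c = k + 1)
    (hi₀ : i₀ ≤ c) (h1 : i₀ = 0 ∨ t i₀ ≤ k) (h2 : ∀ i, i₀ < i → i ≤ c → t i = k + 1) :
    ladderIdeal R m n (lowerBound t c k) d i₀ = ladderIdeal R m n t d c ⊔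
      boundedMinors (Matrix.mvPolynomialX (Fin m) (Fin n) R) k c d := by
  have hlow : ∀ i, lowerBound t c k i ≤ t i := by
    intro i; unfold lowerBound; split_ifs
    · exact min_le_left _ _
    · exact le_rfl
  have hlc : lowerBound t c k c = k := by simp [lowerBound, hk]
  apply le_antisymm
  · rw [ladderIdeal_le_iff]
    constructor
    · intro i hi
      by_cases hic : i ≤ c
      · by_cases hik : t i ≤ k
        · rw [show lowerBound t c k i = t i by simp [lowerBound, hic, hik]]
          exact le_sup_of_le_left (boundedMinors_le_ladderIdeal hi)
        · rw [show lowerBound t c k i = k by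
            rw [lowerBound, if_pos hic, min_eq_right (by omega)]]
          exact le_sup_of_le_right (boundedMinors_mono _ _ hic le_rfl)
      · rw [show lowerBound t c k i = t i by simp [lowerBound, hic]]
        exact le_sup_of_le_left (boundedMinors_le_ladderIdeal hi)
    · intro i hi
      by_cases hik : t i ≤ k
      · rw [show lowerBound t c k i = t i by simp [lowerBound, hi.trans hi₀, hik]]
        exact le_sup_of_le_left (boundedMinors_succ_le_ladderIdeal (hi.trans hi₀))
      · have h0 : i₀ = 0 := by
          rcases h1 with h1 | h1
          · exact h1
          · have := ht.monotone hi; omega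
        obtain rfl : i = 0 := by omega
        rw [show lowerBound t c k 0 = k by
            rw [lowerBound, if_pos (Nat.zero_le _), min_eq_right (by omega)]]
        rcases Nat.eq_zero_or_pos k with rfl | hk0
        · rw [boundedMinors_zero, boundedMinors_zero]; exact le_sup_right
        · rw [boundedMinors_eq_bot_of_row_lt _ _ hk0]; exact bot_le
  · refine sup_le ?_ ?_
    · rw [ladderIdeal_le_iff]
      constructor
      · intro i hi
        exact (boundedMinors_antitone _ (hlow i) _ _).trans (boundedMinors_le_ladderIdeal hi)
      · intro i hi
        by_cases hii : i ≤ i₀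
        · exact (boundedMinors_antitone _ (hlow i) _ _).trans
            (boundedMinors_succ_le_ladderIdeal hii)
        · rw [h2 i (by omega) hi]
          refine (boundedMinors_succ_col_le _ _ _ _).trans
            ((boundedMinors_mono _ _ hi le_rfl).trans ?_)
          have := boundedMinors_le_ladderIdeal (R := R) (n := n) (t := lowerBound t c k) (d := d)
            (c := i₀) hc
          rwa [hlc] at this
    · have := boundedMinors_le_ladderIdeal (R := R) (n := n) (t := lowerBound t c k) (d := d)
        (c := i₀) hc
      rwa [hlc] at this

/-- Index set of the minors bordered by the row `c` and the column `d`. -/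
def CornerIndex (m n k c d : ℕ) : Type :=
  {p : (Fin k → Fin m) × (Fin k → Fin n) // (∀ l, (p.1 l : ℕ) < c) ∧ ∀ l, (p.2 l : ℕ) < d}

/-- The minors of size `k` strictly before row `c` and column `d`. -/
noncomputable def cornerMinor (R : Type*) [CommRing R] {m n k c d : ℕ} (p : CornerIndex m n k c d) :
    MvPolynomial (Fin m × Fin n) R :=
  ((Matrix.mvPolynomialX (Fin m) (Fin n) R).submatrix p.1.1 p.1.2).det

/-- The minors of size `k + 1` with last row `c` and last column `d`. -/
noncomputable def borderedMinor (R : Type*) [CommRing R] {m n k : ℕ} (c : Fin m) (d : Fin n)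
    (p : CornerIndex m n k c d) : MvPolynomial (Fin m × Fin n) R :=
  ((Matrix.mvPolynomialX (Fin m) (Fin n) R).submatrix
    (Fin.cons c p.1.1 : Fin (k + 1) → Fin m) (Fin.cons d p.1.2 : Fin (k + 1) → Fin n)).det

theorem span_range_cornerMinor (k c d : ℕ) :
    Ideal.span (Set.range (cornerMinor R : CornerIndex m n k c d → _)) =
      boundedMinors (Matrix.mvPolynomialX (Fin m) (Fin n) R) k c d := by
  unfold boundedMinors
  congr 1
  ext x
  constructor
  · rintro ⟨p, rfl⟩
    exact ⟨_, _, p.2.1, p.2.2, rfl⟩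
  · rintro ⟨f, g, hf, hg, rfl⟩
    exact ⟨⟨(f, g), hf, hg⟩, rfl⟩

theorem ladderIdeal_succ_eq_sup_span {k : ℕ} (c : Fin m) (d : Fin n)
    (hc : t c = k + 1) (hc1 : t (c + 1) = k + 1) :
    ladderIdeal R m n t d (c + 1) = ladderIdeal R m n t d c ⊔
      Ideal.span (Set.range (borderedMinor R c d : CornerIndex m n k c d → _)) := by
  rw [ladderIdeal_succ, hc1]
  apply le_antisymm
  · refine sup_le le_sup_left ((boundedMinors_succ_le_sup_corner _ k c d).trans
      (sup_le (sup_le ?_ ?_) ?_))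
    · rw [← hc]
      exact le_sup_of_le_left (boundedMinors_succ_le_ladderIdeal le_rfl)
    · rw [← hc1]
      exact le_sup_of_le_left (boundedMinors_le_ladderIdeal c.2)
    · refine le_sup_of_le_right (Ideal.span_mono ?_)
      rintro _ ⟨A, B, hA, hB, rfl⟩
      exact ⟨⟨(A, B), hA, hB⟩, rfl⟩
  · refine sup_le le_sup_left (le_sup_of_le_right (Ideal.span_le.2 ?_))
    rintro _ ⟨p, rfl⟩
    refine det_mem_boundedMinors _ (Fin.cases ?_ fun l => ?_) (Fin.cases ?_ fun l => ?_)
    · simp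
    · simpa using (p.2.1 l).trans (Nat.lt_succ_self _)
    · simp
    · simpa using (p.2.2 l).trans (Nat.lt_succ_self _)

theorem cornerMinor_mul_borderedMinor {k : ℕ} (c : Fin m) (d : Fin n)
    (hc : t c = k + 1) (hc1 : t (c + 1) = k + 1) {p₀ : CornerIndex m n k c d}
    (hp₀ : NzdMod (ladderIdeal R m n t d c) (cornerMinor R p₀)) (p : CornerIndex m n k c d) :
    cornerMinor R p₀ * borderedMinor R c d p - cornerMinor R p * borderedMinor R c d p₀ ∈
      ladderIdeal R m n t d c := by
  set W := ladderIdeal R m n t d c with hW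
  set Y := (Matrix.mvPolynomialX (Fin m) (Fin n) R).map (Ideal.Quotient.mk W) with hY
  have hdet : ∀ {r : ℕ} (f : Fin r → Fin m) (g : Fin r → Fin n), (Y.submatrix f g).det =
      Ideal.Quotient.mk W ((Matrix.mvPolynomialX (Fin m) (Fin n) R).submatrix f g).det := by
    intro r f g
    rw [RingHom.map_det]
    rfl
  rw [← Ideal.Quotient.eq_zero_iff_mem, map_sub, map_mul, map_mul, sub_eq_zero]
  have key := det_mul_bordered_det_eq Y c d p₀.1.1 p.1.1 p₀.1.2 p.1.2 ?_ ?_ ?_ ?_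
  · simpa only [hdet, cornerMinor, borderedMinor] using key
  · intro l
    rw [hdet, Ideal.Quotient.eq_zero_iff_mem]
    have h : boundedMinors _ (t c) c (d + 1) ≤ W := boundedMinors_succ_le_ladderIdeal le_rfl
    rw [hc] at h
    refine h (det_mem_boundedMinors _ (Fin.cases ?_ fun l => ?_) (Fin.cases ?_ fun l => ?_))
    · simpa using p.2.1 l
    · simpa using p₀.2.1 l
    · simp
    · simpa using (p₀.2.2 l).trans (Nat.lt_succ_self _)
  · intro l q
    rw [hdet, Ideal.Quotient.eq_zero_iff_mem]
    have h : boundedMinors _ (t c) c d ≤ W := boundedMinors_le_ladderIdeal c.2.le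
    rw [hc] at h
    refine h (det_mem_boundedMinors _ (Fin.cases ?_ fun l => ?_) (Fin.cases ?_ fun l => ?_))
    · simpa using p.2.1 l
    · simpa using p₀.2.1 l
    · simpa using p.2.2 q
    · simpa using p₀.2.2 l
  · intro q
    rw [hdet, Ideal.Quotient.eq_zero_iff_mem]
    have h : boundedMinors _ (t (c + 1)) (c + 1) d ≤ W := boundedMinors_le_ladderIdeal c.2
    rw [hc1] at h
    refine h (det_mem_boundedMinors _ (Fin.cases ?_ fun l => ?_) (Fin.cases ?_ fun l => ?_))
    · simp
    · simpa using (p₀.2.1 l).trans (Nat.lt_succ_self _)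
    · simpa using p.2.2 q
    · simpa using p₀.2.2 l
  · rw [hdet]
    exact nzdMod_iff.1 hp₀

theorem cornerMinor_mem_freeOf {k : ℕ} (c : Fin m) (d : Fin n) (p : CornerIndex m n k c d) :
    cornerMinor R p ∈ freeOf R (c, d) := by
  refine det_mem_subring _ _ fun a b => X_mem_freeOf fun h => ?_
  have h1 := p.2.1 a
  have h2 := congrArg Prod.fst h
  simp only at h2
  rw [h2] at h1
  exact lt_irrefl _ h1

theorem borderedMinor_sub_mem_freeOf {k : ℕ} (c : Fin m) (d : Fin n) (p : CornerIndex m n k c d) :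
    borderedMinor R c d p - MvPolynomial.X (c, d) * cornerMinor R p ∈ freeOf R (c, d) := by
  rw [borderedMinor, det_eq_entry_mul_add _ 0 0]
  have h1 : ((Matrix.mvPolynomialX (Fin m) (Fin n) R).submatrix
    (Fin.cons c p.1.1 : Fin (k + 1) → Fin m) (Fin.cons d p.1.2 : Fin (k + 1) → Fin n)).submatrix
      (Fin.succAbove 0) (Fin.succAbove 0) =
      (Matrix.mvPolynomialX (Fin m) (Fin n) R).submatrix p.1.1 p.1.2 := by
    ext a b; simp
  rw [h1]
  have h2 := det_updateRow_mem_freeOf (v := (c, d))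
    ((Matrix.mvPolynomialX (Fin m) (Fin n) R).submatrix
    (Fin.cons c p.1.1 : Fin (k + 1) → Fin m) (Fin.cons d p.1.2 : Fin (k + 1) → Fin n)) 0 0 ?_
  · convert h2 using 1
    simp [cornerMinor]
  · intro a b hab
    refine X_mem_freeOf fun h => hab ?_
    simp only [Prod.mk.injEq] at h ⊢
    obtain ⟨h3, h4⟩ := h
    refine ⟨?_, ?_⟩
    · revert h3
      refine Fin.cases (fun _ => rfl) (fun l hl => ?_) a
      have := p.2.1 l
      rw [Fin.cons_succ] at hl
      rw [hl] at this
      exact absurd this (lt_irrefl _)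
    · revert h4
      refine Fin.cases (fun _ => rfl) (fun l hl => ?_) b
      have := p.2.2 l
      rw [Fin.cons_succ] at hl
      rw [hl] at this
      exact absurd this (lt_irrefl _)

end Ladder

section LadderNzd

variable {R : Type*} [CommRing R] {m n : ℕ} {t : ℕ → ℕ}

/-- The number of entries of `A` below `i`. -/
def countLT {r : ℕ} (A : Fin r → Fin m) (i : ℕ) : ℕ :=
  (Finset.univ.filter fun l => (A l : ℕ) < i).card

theorem countLT_comp_succAbove {r : ℕ} (A : Fin (r + 1) → Fin m) (l : Fin (r + 1)) (i : ℕ) :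
    countLT (A ∘ l.succAbove) i + (if (A l : ℕ) < i then 1 else 0) = countLT A i := by
  simp only [countLT, Finset.card_filter]
  rw [Fin.sum_univ_succAbove _ l, add_comm]
  rfl

theorem countLT_cons {r : ℕ} (a : Fin m) (A : Fin r → Fin m) (i : ℕ) :
    countLT (Fin.cons a A : Fin (r + 1) → Fin m) i =
      (if (a : ℕ) < i then 1 else 0) + countLT A i := by
  simp only [countLT, Finset.card_filter]
  rw [Fin.sum_univ_succ]
  simp

theorem countLT_mono {r : ℕ} (A : Fin r → Fin m) {i j : ℕ} (h : i ≤ j) :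
    countLT A i ≤ countLT A j :=
  Finset.card_le_card fun l hl => by
    simp only [Finset.mem_filter, Finset.mem_univ, true_and] at hl ⊢
    omega

theorem countLT_eq_of_forall {r : ℕ} (A : Fin r → Fin m) {i : ℕ} (h : ∀ l, (A l : ℕ) < i) :
    countLT A i = r := by
  simp [countLT, h]

theorem countLT_lt_of_mem {r : ℕ} (A : Fin r → Fin m) {i j : ℕ} (l : Fin r) (h1 : i ≤ A l)
    (h2 : (A l : ℕ) < j) : countLT A i < countLT A j := by
  refine Finset.card_lt_card ⟨fun q hq => ?_, fun h => ?_⟩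
  · simp only [Finset.mem_filter, Finset.mem_univ, true_and] at hq ⊢
    omega
  · have := @h l (by simpa using h2)
    simp only [Finset.mem_filter, Finset.mem_univ, true_and] at this
    omega

variable (R) in
/-- The minor on the rows `A` and the first columns. -/
noncomputable def leftMinor {r : ℕ} (hr : r ≤ n) (A : Fin r → Fin m) :
    MvPolynomial (Fin m × Fin n) R :=
  ((Matrix.mvPolynomialX (Fin m) (Fin n) R).submatrix A (Fin.castLE hr)).det

theorem leftMinor_mem_freeOf {r : ℕ} (hr : r ≤ n) (A : Fin r → Fin m) {v : Fin m × Fin n}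
    (hv : r ≤ v.2) : leftMinor R hr A ∈ freeOf R v := by
  refine det_mem_subring _ _ fun a b => X_mem_freeOf ?_
  rintro rfl
  simp only [Fin.val_castLE] at hv
  omega

theorem nzdMod_leftMinor_succ {r : ℕ} (hr : r + 1 ≤ n) (A : Fin (r + 1) → Fin m)
    (hA : Function.Injective A) (l : Fin (r + 1)) {W : Ideal (MvPolynomial (Fin m × Fin n) R)}
    (hW : IdealFreeOf (A l, (⟨r, hr⟩ : Fin n)) W)
    (h : NzdMod W (leftMinor R (Nat.le_of_succ_le hr) (A ∘ l.succAbove))) :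
    NzdMod W (leftMinor R hr A) := by
  refine nzdMod_det_of_free hW _ l (Fin.last r) rfl ?_ ?_
  · intro l' q' hne
    refine X_mem_freeOf fun h => hne ?_
    simp only [Prod.mk.injEq] at h ⊢
    exact ⟨hA h.1, Fin.ext (by simpa using congrArg Fin.val h.2)⟩
  · rw [Matrix.submatrix_submatrix]
    convert h using 3
    rw [leftMinor]
    congr 2
    ext q
    simp [Fin.succAbove_last]

theorem nzdMod_bot_leftMinor : ∀ {r : ℕ} (hr : r ≤ n) (A : Fin r → Fin m),
    Function.Injective A → NzdMod ⊥ (leftMinor R hr A)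
  | 0, _, _, _ => fun u hu => by simpa [leftMinor] using hu
  | r + 1, hr, A, hA => nzdMod_leftMinor_succ hr A hA 0 (idealFreeOf_bot _)
      (nzdMod_bot_leftMinor _ _ (hA.comp (Fin.succAbove_right_injective)))

variable (R n) in
/-- Minors on the first columns whose rows avoid the bounds `t` are nonzerodivisors. -/
def LadderNzd (m d c : ℕ) : Prop :=
  ∀ t, SlowMono t → ∀ (r : ℕ) (hr : r ≤ n) (A : Fin r → Fin m), Function.Injective A →
    (∀ i ≤ m, countLT A i < t i) → NzdMod (ladderIdeal R m n t d c) (leftMinor R hr A)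

theorem exists_corner_nzd (ht : SlowMono t) {k : ℕ} (c : Fin m) (d : Fin n)
    (hpos : ∀ i, 1 ≤ t i)
    (hc : t c = k + 1) (hc1 : t (c + 1) = k + 1) (hkc : k ≤ c) (hkd : k ≤ d)
    (ih : LadderNzd R n m d c) :
    ∃ p₀ : CornerIndex m n k c d, NzdMod (ladderIdeal R m n t d c) (cornerMinor R p₀) := by
  have hA : ∀ l : Fin k, c - k + (l : ℕ) < m := fun l => by omega
  refine ⟨⟨(fun l => ⟨c - k + l, hA l⟩, Fin.castLE (hkd.trans d.2.le)), fun l => ?_,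
    fun l => ?_⟩, ih t ht k (hkd.trans d.2.le) _ ?_ ?_⟩
  · simp only; omega
  · simp only [Fin.val_castLE]; omega
  · intro a b hab
    simpa [Fin.ext_iff] using hab
  · intro i hi
    have hle : countLT (fun l : Fin k => (⟨c - k + l, hA l⟩ : Fin m)) i ≤ k := by
      refine (Finset.card_filter_le _ _).trans ?_
      simp
    have hle2 : countLT (fun l : Fin k => (⟨c - k + l, hA l⟩ : Fin m)) i ≤ i - (c - k) := by
      have : (Finset.univ.filter fun l : Fin k => c - k + (l : ℕ) < i).card ≤
          (Finset.range (i - (c - k))).card := by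
        refine Finset.card_le_card_of_injOn (fun l => (l : ℕ)) ?_ ?_
        · intro l hl
          simp only [Finset.coe_filter, Finset.mem_univ, true_and, Set.mem_ofPred_eq] at hl
          simp only [Finset.coe_range, Set.mem_Iio]
          omega
        · intro a _ b _ hab
          exact Fin.ext hab
      simpa [countLT] using this
    have h1 := hpos i
    show countLT (fun l : Fin k => (⟨c - k + l, hA l⟩ : Fin m)) i < t i
    rcases le_total i c with hic | hic
    · have := ht.le_add i (c - i)
      rw [Nat.add_sub_cancel' hic] at this
      omega
    · have := ht.monotone hic
      omega

variable (R) in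
/-- The first columns of the generic matrix, preceded by the column `d` truncated after row `c`. -/
noncomputable def cutMatrix {r : ℕ} (hr : r ≤ n) (c : Fin m) (d : Fin n) :
    Matrix (Fin m) (Fin (r + 1)) (MvPolynomial (Fin m × Fin n) R) :=
  Matrix.of fun i => Fin.cons (if i ≤ c then MvPolynomial.X (i, d) else 0)
    fun q => MvPolynomial.X (i, Fin.castLE hr q)

theorem cutMatrix_zero {r : ℕ} (hr : r ≤ n) (c i : Fin m) (d : Fin n) :
    cutMatrix R hr c d i 0 = if i ≤ c then MvPolynomial.X (i, d) else 0 := rfl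

theorem cutMatrix_succ {r : ℕ} (hr : r ≤ n) (c i : Fin m) (d : Fin n) (q : Fin r) :
    cutMatrix R hr c d i q.succ = MvPolynomial.X (i, Fin.castLE hr q) := rfl

theorem det_cutMatrix_mem {r k : ℕ} (hr : r ≤ n) (c : Fin m) (d : Fin n) (hrd : r ≤ d)
    (A : Fin (r + 1) → Fin m) (hA : k ≤ countLT A (c + 1)) :
    ((cutMatrix R hr c d).submatrix A id).det ∈
      boundedMinors (Matrix.mvPolynomialX (Fin m) (Fin n) R) k (c + 1) (d + 1) := by
  refine det_submatrix_mem_of_card _ (fun i : Fin m => (i : ℕ) < c + 1) (fun f g hf => ?_) _ _ hA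
  have : (cutMatrix R hr c d).submatrix f g = (Matrix.mvPolynomialX (Fin m) (Fin n) R).submatrix f
      ((Fin.cons d (Fin.castLE hr) : Fin (r + 1) → Fin n) ∘ g) := by
    ext a b : 2
    simp only [Matrix.submatrix_apply, Function.comp]
    induction g b using Fin.cases with
    | zero =>
      rw [cutMatrix_zero, if_pos (Fin.le_def.2 (Nat.lt_succ_iff.1 (hf a)))]
      rfl
    | succ q => rfl
  rw [this]
  refine det_mem_boundedMinors _ hf fun l => ?_
  simp only [Function.comp]
  induction g l using Fin.cases with
  | zero => simp
  | succ q => simp only [Fin.cons_succ, Fin.val_castLE]; omega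

theorem castLE_ne {r : ℕ} (hr : r ≤ n) (d : Fin n) (hrd : r ≤ d) (q : Fin r) :
    Fin.castLE hr q ≠ d := fun hq => by
  have := congrArg Fin.val hq
  rw [Fin.val_castLE] at this
  omega

theorem cutMatrix_mem_freeOf {r : ℕ} (hr : r ≤ n) (c : Fin m) (d : Fin n) (hrd : r ≤ d)
    {i j : Fin m} (q : Fin (r + 1)) (h : i ≠ j ∨ q ≠ 0) :
    cutMatrix R hr c d i q ∈ freeOf R (j, d) := by
  induction q using Fin.cases with
  | zero =>
    rw [cutMatrix_zero]
    split_ifs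
    · exact X_mem_freeOf (by simpa using h)
    · exact zero_mem _
  | succ q =>
    rw [cutMatrix_succ]
    exact X_mem_freeOf (by simp [castLE_ne hr d hrd])

variable (R) in
/-- The truncated matrix with rows `c` and `A`, and corner entry set to zero. -/
noncomputable def cutTail {r : ℕ} (hr : r ≤ n) (c : Fin m) (d : Fin n) (A : Fin r → Fin m) :
    Matrix (Fin (r + 1)) (Fin (r + 1)) (MvPolynomial (Fin m × Fin n) R) :=
  ((cutMatrix R hr c d).submatrix (Fin.cons c A : Fin (r + 1) → Fin m) id).updateRow 0
    (Function.update (((cutMatrix R hr c d).submatrix (Fin.cons c A) id) 0) 0 0)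

theorem det_cutMatrix {r : ℕ} (hr : r ≤ n) (c : Fin m) (d : Fin n) (A : Fin r → Fin m) :
    ((cutMatrix R hr c d).submatrix (Fin.cons c A : Fin (r + 1) → Fin m) id).det =
      MvPolynomial.X (c, d) * leftMinor R hr A + (cutTail R hr c d A).det := by
  rw [det_eq_entry_mul_add _ 0 0, cutTail]
  congr 1
  have e1 : (cutMatrix R hr c d).submatrix (Fin.cons c A : Fin (r + 1) → Fin m) id 0 0 =
      MvPolynomial.X (c, d) := by
    rw [Matrix.submatrix_apply, id, Fin.cons_zero, cutMatrix_zero, if_pos le_rfl]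
  have e2 : ((cutMatrix R hr c d).submatrix (Fin.cons c A : Fin (r + 1) → Fin m) id).submatrix
      (Fin.succAbove 0) (Fin.succAbove 0) =
      (Matrix.mvPolynomialX (Fin m) (Fin n) R).submatrix A (Fin.castLE hr) := by
    ext a b : 2
    simp only [Matrix.submatrix_apply, Fin.zero_succAbove, id, Fin.cons_succ, cutMatrix_succ]
    rfl
  rw [e1, e2]
  simp [leftMinor]

theorem det_cutTail_mem_freeOf {r : ℕ} (hr : r ≤ n) (c : Fin m) (d : Fin n) (hrd : r ≤ d)
    (A : Fin r → Fin m) (hA : ∀ l, A l ≠ c) : (cutTail R hr c d A).det ∈ freeOf R (c, d) := by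
  refine det_updateRow_mem_freeOf _ 0 0 fun l' q' h => ?_
  rw [Matrix.submatrix_apply]
  refine cutMatrix_mem_freeOf hr c d hrd _ ?_
  by_contra! hcon
  obtain ⟨h1, h2⟩ := hcon
  simp only [id] at h2
  subst h2
  induction l' using Fin.cases with
  | zero => exact h rfl
  | succ l' => exact hA l' (by simpa using h1)

theorem nzdMod_det_cutTail {r : ℕ} (hr : r ≤ n) (c : Fin m) (d : Fin n) (hrd : r ≤ d)
    (A : Fin r → Fin m) (hA : Function.Injective A) (l : Fin r) (hl : A l < c)
    {W : Ideal (MvPolynomial (Fin m × Fin n) R)} (hW : IdealFreeOf (A l, d) W)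
    (hnz : NzdMod W (leftMinor R hr
      ((Fin.cons c A : Fin (r + 1) → Fin m) ∘ l.succ.succAbove))) :
    NzdMod W (cutTail R hr c d A).det := by
  refine nzdMod_det_of_free hW _ l.succ 0 ?_ ?_ ?_
  · rw [cutTail, Matrix.updateRow_ne (Fin.succ_ne_zero l), Matrix.submatrix_apply, id,
      Fin.cons_succ, cutMatrix_zero, if_pos hl.le]
  · intro l' q' hne
    rw [cutTail]
    by_cases hl' : l' = 0
    · subst hl'
      rw [Matrix.updateRow_self]
      by_cases hq' : q' = 0
      · rw [hq', Function.update_self]; exact zero_mem _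
      · rw [Function.update_of_ne hq', Matrix.submatrix_apply]
        exact cutMatrix_mem_freeOf hr c d hrd _ (.inr hq')
    · rw [Matrix.updateRow_ne hl', Matrix.submatrix_apply]
      refine cutMatrix_mem_freeOf hr c d hrd _ ?_
      by_contra! hcon
      obtain ⟨l', rfl⟩ := Fin.exists_succ_eq.2 hl'
      rw [Fin.cons_succ] at hcon
      exact hne (by rw [hA hcon.1, show q' = 0 from hcon.2])
  · have hminor : ((cutTail R hr c d A).submatrix l.succ.succAbove (Fin.succAbove 0)).det =
        leftMinor R hr ((Fin.cons c A : Fin (r + 1) → Fin m) ∘ l.succ.succAbove) := by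
      rw [leftMinor]
      congr 1
      ext a b : 2
      rw [Matrix.submatrix_apply, Fin.zero_succAbove, cutTail]
      rcases eq_or_ne (l.succ.succAbove a) 0 with h0 | h0
      · rw [h0, Matrix.updateRow_self, Function.update_of_ne (Fin.succ_ne_zero b),
          Matrix.submatrix_apply, Matrix.submatrix_apply, id, cutMatrix_succ, Function.comp, h0]
        rfl
      · rw [Matrix.updateRow_ne h0, Matrix.submatrix_apply, Matrix.submatrix_apply, id,
          cutMatrix_succ]
        rfl
    rw [hminor]
    exact hnz

theorem ladderNzd_succ_of_bounds (ht : SlowMono t) {k : ℕ} (c : Fin m) (d : Fin n)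
    (hpos : ∀ i, 1 ≤ t i) (hc : t c = k + 1) (hc1 : t (c + 1) = k + 1) (hkc : k ≤ c) (hkd : k ≤ d)
    (ih : ∀ c' ≤ (c : ℕ), LadderNzd R n m d c') {r : ℕ} (hr : r ≤ n) (hrd : r ≤ d)
    (A : Fin r → Fin m) (hA : Function.Injective A) (hF : ∀ i ≤ m, countLT A i < t i) :
    NzdMod (ladderIdeal R m n t d (c + 1)) (leftMinor R hr A) := by
  obtain ⟨p₀, hp₀⟩ := exists_corner_nzd (R := R) ht c d hpos hc hc1 hkc hkd (ih c le_rfl)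
  have hW : IdealFreeOf (c, d) (ladderIdeal R m n t d c) := idealFreeOf_ladderIdeal le_rfl le_rfl
  have hzW := ih c le_rfl t ht r hr A hA hF
  obtain ⟨i₀, hi₀, h1, h2⟩ := exists_last_le t c k ht hc
  have hV' := ladderIdeal_lowerBound (R := R) (n := n) (d := d) ht c.2.le hc hi₀ h1 h2
  have hslow := slowMono_lowerBound ht hc hc1
  have main : ∀ y ∈ freeOf R (c, d),
      NzdMod (ladderIdeal R m n (lowerBound t c k) d i₀) y →
      (y = leftMinor R hr A ∨ MvPolynomial.X (c, d) * leftMinor R hr A + y ∈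
        ladderIdeal R m n t d (c + 1)) →
      NzdMod (ladderIdeal R m n t d (c + 1)) (leftMinor R hr A) := by
    intro y hyfree hy hzy
    rw [ladderIdeal_succ_eq_sup_span c d hc hc1] at hzy ⊢
    rw [hV', ← span_range_cornerMinor] at hy
    refine (isVarMod_splitVarMod hW).nzdMod_sup_span (δ := cornerMinor R) (i₀ := p₀)
      (ε := fun p => borderedMinor R c d p - MvPolynomial.X (c, d) * cornerMinor R p)
      (fun p => by ring)
      (fun p => splitVarMod_of_mem_freeOf _ (cornerMinor_mem_freeOf c d p))
      (fun p => splitVarMod_of_mem_freeOf _ (borderedMinor_sub_mem_freeOf c d p)) hp₀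
      (cornerMinor_mul_borderedMinor c d hc hc1 hp₀)
      (splitVarMod_of_mem_freeOf _ (leftMinor_mem_freeOf hr A hrd))
      (splitVarMod_of_mem_freeOf _ hyfree) hzW hy hzy
  rcases Nat.eq_zero_or_pos k with rfl | hk
  · refine main _ (leftMinor_mem_freeOf hr A hrd) ?_ (.inl rfl)
    rw [hV', boundedMinors_zero, sup_top_eq]
    exact nzdMod_top _
  by_cases hpc : countLT A c < k
  · refine main _ (leftMinor_mem_freeOf hr A hrd) (ih i₀ hi₀ _ hslow r hr A hA ?_) (.inl rfl)
    intro i hi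
    have := hF i hi
    unfold lowerBound
    split_ifs with hic
    · have := countLT_mono A hic
      exact lt_min (by omega) (by omega)
    · exact this
  have hpc1 : countLT A c = k := by have := hF c c.2.le; omega
  have hpc2 : countLT A (c + 1) ≤ k := by have := hF (c + 1) c.2; omega
  have hcA : ∀ l, A l ≠ c := by
    intro l hl
    have := countLT_lt_of_mem A (i := c) (j := c + 1) l (by rw [hl]) (by rw [hl]; omega)
    omega
  obtain ⟨r, rfl⟩ : ∃ r', r = r' + 1 := by
    refine ⟨r - 1, ?_⟩
    have : countLT A c ≤ r := (Finset.card_filter_le _ _).trans (by simp)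
    omega
  obtain ⟨l, hlc, hlmax⟩ : ∃ l, (A l : ℕ) < c ∧ ∀ q, (A q : ℕ) < c → A q ≤ A l := by
    have hne : (Finset.univ.filter fun l => (A l : ℕ) < c).Nonempty := by
      rw [← Finset.card_pos]
      exact hk.trans_le hpc1.ge
    obtain ⟨l, hl, hmax⟩ := Finset.exists_max_image _ A hne
    exact ⟨l, by simpa using hl, fun q hq => hmax q (by simpa using hq)⟩
  have hcount : countLT A (A l + 1) = k := by
    rw [← hpc1, countLT, countLT]
    congr 1
    ext q
    simp only [Finset.mem_filter, Finset.mem_univ, true_and]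
    constructor
    · intro h; omega
    · intro h
      have : (A q : ℕ) ≤ A l := hlmax q h
      omega
  have hi₀l : i₀ ≤ A l := by
    by_contra hcon
    have h3 := hF (A l + 1) (A l).2
    have h4 := ht.monotone (show (A l : ℕ) + 1 ≤ i₀ by omega)
    omega
  refine main _ (det_cutTail_mem_freeOf hr c d hrd A hcA) ?_ (.inr ?_)
  · refine nzdMod_det_cutTail hr c d hrd A hA l hlc (idealFreeOf_ladderIdeal hi₀l le_rfl) ?_
    have hinj : Function.Injective (Fin.cons c A : Fin (r + 1 + 1) → Fin m) :=
      Fin.cons_injective_iff.2 ⟨by rintro ⟨q, hq⟩; exact hcA q hq, hA⟩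
    refine ih i₀ hi₀ _ hslow _ hr _ (hinj.comp Fin.succAbove_right_injective) ?_
    intro i hi
    have h3 := countLT_comp_succAbove (Fin.cons c A : Fin (r + 1 + 1) → Fin m) l.succ i
    rw [countLT_cons, Fin.cons_succ] at h3
    have h4 := hF i hi
    unfold lowerBound
    split_ifs with hic
    · rw [if_neg (by omega : ¬ (c : ℕ) < i)] at h3
      refine lt_min ?_ ?_
      · omega
      · by_cases hli : (A l : ℕ) < i
        · rw [if_pos hli] at h3
          have := countLT_mono A hic
          omega
        · have := countLT_lt_of_mem A (i := i) (j := A l + 1) l (by omega) (by omega)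
          rw [if_neg hli] at h3
          omega
    · rw [if_pos (by omega), if_pos (by omega)] at h3
      omega
  · rw [← det_cutMatrix]
    have hV : boundedMinors _ (t (c + 1)) (c + 1) (d + 1) ≤ ladderIdeal R m n t d (c + 1) :=
      boundedMinors_succ_le_ladderIdeal le_rfl
    rw [hc1] at hV
    refine hV (det_cutMatrix_mem hr c d hrd _ ?_)
    have h3 := countLT_cons c A (c + 1)
    rw [if_pos (Nat.lt_succ_self _)] at h3
    have h4 := countLT_mono A (show (c : ℕ) ≤ c + 1 by omega)
    omega

theorem ladderNzd_succ (c : Fin m) (d : Fin n) (ih : ∀ c' ≤ (c : ℕ), LadderNzd R n m d c') :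
    LadderNzd R n m d (c + 1) := by
  intro t ht r hr A hA hF
  have hpos : ∀ i, 1 ≤ t i := fun i =>
    (Nat.zero_lt_of_lt (hF 0 (Nat.zero_le _))).trans_le (ht.monotone (Nat.zero_le i))
  rcases eq_or_ne (t (c + 1)) (t c + 1) with hstep | hstep
  · rw [ladderIdeal_succ_of_step hstep]
    exact ih c le_rfl t ht r hr A hA hF
  obtain ⟨k, hc⟩ : ∃ k, t c = k + 1 := ⟨t c - 1, by have := hpos c; omega⟩
  have hc1 : t (c + 1) = k + 1 := by have := ht c; omega
  by_cases hkcd : k ≤ c ∧ k ≤ d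
  swap
  · rw [ladderIdeal_succ_of_lt (by omega)]
    exact ih c le_rfl t ht r hr A hA hF
  induction r with
  | zero =>
    exact ladderNzd_succ_of_bounds ht c d hpos hc hc1 hkcd.1 hkcd.2 ih hr (Nat.zero_le _) A hA hF
  | succ r ihr =>
    by_cases hrd : r + 1 ≤ d
    · exact ladderNzd_succ_of_bounds ht c d hpos hc hc1 hkcd.1 hkcd.2 ih hr hrd A hA hF
    obtain ⟨l, hl⟩ : ∃ l, (c : ℕ) + 1 ≤ A l := by
      by_contra! hcon
      have h1 := countLT_eq_of_forall A hcon
      have h2 := hF (c + 1) c.2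
      omega
    refine nzdMod_leftMinor_succ hr A hA l (idealFreeOf_ladderIdeal hl (by simp only; omega))
      (ihr _ _ (hA.comp Fin.succAbove_right_injective) fun i hi => ?_)
    have h1 := countLT_comp_succAbove A l i
    have h2 := hF i hi
    omega

theorem ladderNzd : ∀ (d : ℕ), d < n → ∀ c ≤ m, LadderNzd R n m d c := by
  intro d
  induction d with
  | zero =>
    intro hd c
    induction c using Nat.strong_induction_on with
    | _ c ih =>
      intro hc
      rcases c with _ | c
      · intro t ht r hr A hA hF
        rw [ladderIdeal_zero_zero fun i hi => Nat.zero_lt_of_lt (hF i hi)]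
        exact nzdMod_bot_leftMinor hr A hA
      · exact ladderNzd_succ ⟨c, hc⟩ ⟨0, hd⟩ fun c' hc' => ih c' (Nat.lt_succ_of_le hc')
          (le_trans hc' (Nat.le_of_succ_le hc))
  | succ d ihd =>
    intro hd c
    induction c using Nat.strong_induction_on with
    | _ c ih =>
      intro hc
      rcases c with _ | c
      · intro t ht r hr A hA hF
        rw [ladderIdeal_succ_zero (Nat.zero_lt_of_lt (hF 0 (Nat.zero_le _)))]
        exact ihd (Nat.lt_of_succ_lt hd) m le_rfl t ht r hr A hA hF
      · exact ladderNzd_succ ⟨c, hc⟩ ⟨d + 1, hd⟩ fun c' hc' => ih c' (Nat.lt_succ_of_le hc')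
          (le_trans hc' (Nat.le_of_succ_le hc))

end LadderNzd

section ExtVanishing

open CategoryTheory

universe u

variable {S : Type u} [CommRing S]

/-- The groups `Ext N M i` vanish for `i < e`. -/
def ExtVanishesBelow (N : ModuleCat.{u} S) (M : Type u) [AddCommGroup M] [Module S M] (e : ℕ) :
    Prop :=
  ∀ i < e, Subsingleton (Abelian.Ext N (ModuleCat.of S M) i)

variable {N : ModuleCat.{u} S} {A B C : Type u} [AddCommGroup A] [Module S A] [AddCommGroup B]
  [Module S B] [AddCommGroup C] [Module S C]

theorem ExtVanishesBelow.mono {e e' : ℕ} (h : ExtVanishesBelow N A e) (he : e' ≤ e) :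
    ExtVanishesBelow N A e' := fun i hi => h i (hi.trans_le he)

theorem shortExact_of_linearMap (f : A →ₗ[S] B) (g : B →ₗ[S] C) (hf : Function.Injective f)
    (hfg : Function.Exact f g) (hg : Function.Surjective g) :
    (ShortComplex.mk (ModuleCat.ofHom f) (ModuleCat.ofHom g) (by
      ext x; exact hfg.apply_apply_eq_zero x)).ShortExact :=
  ModuleCat.shortComplex_shortExact _ hfg hf hg

theorem ExtVanishesBelow.of_exact_left (f : A →ₗ[S] B) (g : B →ₗ[S] C)
    (hf : Function.Injective f) (hfg : Function.Exact f g) (hg : Function.Surjective g) {e : ℕ}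
    (hB : ExtVanishesBelow N B (e + 1)) (hC : ExtVanishesBelow N C e) :
    ExtVanishesBelow N A (e + 1) := by
  have hS := shortExact_of_linearMap f g hf hfg hg
  intro i hi
  rcases i with _ | i
  · refine ⟨fun x y => ?_⟩
    have h0 := hB 0 (Nat.succ_pos e)
    have : Subsingleton (N ⟶ ModuleCat.of S B) := Abelian.Ext.addEquiv₀.subsingleton_congr.1 h0
    have : Mono (ModuleCat.ofHom f) := hS.mono_f
    apply Abelian.Ext.addEquiv₀.injective
    exact (cancel_mono (ModuleCat.ofHom f)).1 (Subsingleton.elim _ _)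
  · have z1 := AddCommGrpCat.isZero_of_iff_subsingleton.mpr (hC i (by omega))
    have z2 := AddCommGrpCat.isZero_of_iff_subsingleton.mpr (hB (i + 1) hi)
    exact AddCommGrpCat.subsingleton_of_isZero <| ShortComplex.Exact.isZero_of_both_zeros
        ((Abelian.Ext.covariant_sequence_exact₁' N hS) i (i + 1) rfl)
        (z1.eq_zero_of_src _) (z2.eq_zero_of_tgt _)

theorem ExtVanishesBelow.of_exact_right (f : A →ₗ[S] B) (g : B →ₗ[S] C)
    (hf : Function.Injective f) (hfg : Function.Exact f g) (hg : Function.Surjective g) {e : ℕ}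
    (hA : ExtVanishesBelow N A (e + 1)) (hB : ExtVanishesBelow N B e) :
    ExtVanishesBelow N C e := by
  have hS := shortExact_of_linearMap f g hf hfg hg
  intro i hi
  have z1 := AddCommGrpCat.isZero_of_iff_subsingleton.mpr (hB i hi)
  have z2 := AddCommGrpCat.isZero_of_iff_subsingleton.mpr (hA (i + 1) (by omega))
  exact AddCommGrpCat.subsingleton_of_isZero <| ShortComplex.Exact.isZero_of_both_zeros
      ((Abelian.Ext.covariant_sequence_exact₃' N hS) i (i + 1) rfl)
      (z1.eq_zero_of_src _) (z2.eq_zero_of_tgt _)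

theorem ExtVanishesBelow.of_subsingleton [Subsingleton A] (e : ℕ) : ExtVanishesBelow N A e := by
  intro i _
  have hz : Limits.IsZero (ModuleCat.of S A) := ModuleCat.isZero_of_subsingleton _
  have h0 : ∀ x : Abelian.Ext N (ModuleCat.of S A) i, x = 0 := fun x => by
    rw [← x.comp_mk₀_id, hz.eq_of_src (𝟙 _) 0, Abelian.Ext.mk₀_zero, Abelian.Ext.comp_zero]
  exact ⟨fun x y => (h0 x).trans (h0 y).symm⟩

theorem ExtVanishesBelow.of_linearEquiv {e : ℕ} (h : ExtVanishesBelow N A e) (φ : A ≃ₗ[S] B) :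
    ExtVanishesBelow N B e := by
  refine ExtVanishesBelow.of_exact_right (A := PUnit) (0 : PUnit.{u + 1} →ₗ[S] A) φ.toLinearMap
    (fun _ _ _ => rfl) ?_ φ.surjective ?_ h
  · intro x
    simp only [LinearEquiv.coe_coe, LinearEquiv.map_eq_zero_iff, Set.mem_range]
    exact ⟨fun h => ⟨0, h.symm⟩, fun ⟨_, h⟩ => h.symm⟩
  · exact .of_subsingleton _

/-- If `W + (g)` and `W + (δ)` are proportional modulo `W`, the vanishing of `Ext` for `S ⧸ W` and
`S ⧸ (W + (δ))` passes to `S ⧸ (W + (g))`. -/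
theorem ExtVanishesBelow.quotient_of_proportional {W : Ideal S} {ι : Type*} {δ g : ι → S} {i₀ : ι}
    (hf : NzdMod W (δ i₀)) (hg : NzdMod W (g i₀))
    (hrel : ∀ i, δ i₀ * g i - δ i * g i₀ ∈ W) {e : ℕ}
    (hW : ExtVanishesBelow N (S ⧸ W) (e + 1))
    (hδ : ExtVanishesBelow N (S ⧸ W ⊔ Ideal.span (Set.range δ)) e) :
    ExtVanishesBelow N (S ⧸ W ⊔ Ideal.span (Set.range g)) e := by
  set V := W ⊔ Ideal.span (Set.range g) with hV
  set V' := W ⊔ Ideal.span (Set.range δ) with hV'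
  set Vb : Submodule S (S ⧸ W) := Submodule.map W.mkQ V
  set Vb' : Submodule S (S ⧸ W) := Submodule.map W.mkQ V'
  have hinj : ∀ z, NzdMod W z → Function.Injective (LinearMap.lsmul S (S ⧸ W) z) := by
    intro z hz
    rw [← LinearMap.ker_eq_bot, LinearMap.ker_eq_bot']
    intro x hx
    obtain ⟨x, rfl⟩ := Ideal.Quotient.mk_surjective x
    exact Ideal.Quotient.eq_zero_iff_mem.2 (hz x (Ideal.Quotient.eq_zero_iff_mem.1 hx))
  have hmap : Vb.map (LinearMap.lsmul S (S ⧸ W) (δ i₀)) =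
      Vb'.map (LinearMap.lsmul S (S ⧸ W) (g i₀)) := by
    have hrel' : ∀ i, g i₀ * δ i - g i * δ i₀ ∈ W := fun i => by
      have := neg_mem (hrel i)
      convert this using 1; ring
    have hsub : ∀ {x y z w : S}, x * y - z * w ∈ W → z • W.mkQ w = x • W.mkQ y := by
      intro x y z w h
      rw [← map_smul, ← map_smul, eq_comm]
      exact (Submodule.Quotient.eq W).2 h
    apply le_antisymm
    · rintro _ ⟨_, ⟨x, hx, rfl⟩, rfl⟩
      obtain ⟨j, hj, h⟩ := (mem_sup_span_range_iff hf hrel x).1 hx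
      exact ⟨_, ⟨j, hj, rfl⟩, hsub h⟩
    · rintro _ ⟨_, ⟨x, hx, rfl⟩, rfl⟩
      obtain ⟨j, hj, h⟩ := (mem_sup_span_range_iff hg hrel' x).1 hx
      exact ⟨_, ⟨j, hj, rfl⟩, hsub h⟩
  have φ : Vb' ≃ₗ[S] Vb := (Submodule.equivMapOfInjective _ (hinj _ hg) Vb').trans
    ((LinearEquiv.ofEq _ _ hmap.symm).trans
      (Submodule.equivMapOfInjective _ (hinj _ hf) Vb).symm)
  have hVb' : ExtVanishesBelow N Vb' (e + 1) :=
    ExtVanishesBelow.of_exact_left Vb'.subtype (Submodule.mkQ Vb') Vb'.injective_subtype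
      (LinearMap.exact_subtype_mkQ _) (Submodule.mkQ_surjective _) hW
      (hδ.of_linearEquiv (Submodule.quotientQuotientEquivQuotient W V' le_sup_left).symm)
  exact (ExtVanishesBelow.of_exact_right Vb.subtype (Submodule.mkQ Vb) Vb.injective_subtype
      (LinearMap.exact_subtype_mkQ _) (Submodule.mkQ_surjective _) (hVb'.of_linearEquiv φ)
      (hW.mono (Nat.le_succ e))).of_linearEquiv
      (Submodule.quotientQuotientEquivQuotient W V le_sup_left)

end ExtVanishing

section LadderCount

/-- Positions that strictly enlarge the ladder ideal when they are adjoined. -/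
def LadderStep (t : ℕ → ℕ) (i j : ℕ) : Prop := t (i + 1) = t i ∧ t i ≤ i + 1 ∧ t i ≤ j + 1

open Classical in
/-- The positions before `(c, d)`, column by column, that strictly enlarge the ladder ideal. -/
noncomputable def ladderSteps (m : ℕ) (t : ℕ → ℕ) (d c : ℕ) : Finset (ℕ × ℕ) :=
  (Finset.range m ×ˢ Finset.range (d + 1)).filter
    fun p => (p.2 < d ∨ p.1 < c) ∧ LadderStep t p.1 p.2

variable {m : ℕ} {t : ℕ → ℕ} {d c : ℕ}

theorem mem_ladderSteps {p : ℕ × ℕ} : p ∈ ladderSteps m t d c ↔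
    p.1 < m ∧ (p.2 < d ∨ p.2 = d ∧ p.1 < c) ∧ LadderStep t p.1 p.2 := by
  simp only [ladderSteps, Finset.mem_filter, Finset.mem_product, Finset.mem_range]
  constructor
  · rintro ⟨⟨h1, h2⟩, h3, h4⟩
    exact ⟨h1, by omega, h4⟩
  · rintro ⟨h1, h2, h3⟩
    exact ⟨⟨h1, by omega⟩, by omega, h3⟩

theorem ladderSteps_subset_succ : ladderSteps m t d c ⊆ ladderSteps m t d (c + 1) := by
  intro p
  simp only [mem_ladderSteps]
  rintro ⟨h1, h2, h3⟩
  exact ⟨h1, by omega, h3⟩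

theorem ladderSteps_succ_zero : ladderSteps m t (d + 1) 0 = ladderSteps m t d m := by
  ext p
  simp only [mem_ladderSteps]
  constructor
  · rintro ⟨h1, h2, h3⟩
    exact ⟨h1, by omega, h3⟩
  · rintro ⟨h1, h2, h3⟩
    exact ⟨h1, by omega, h3⟩

theorem card_ladderSteps_succ (hc : c < m) (h : LadderStep t c d) :
    (ladderSteps m t d c).card + 1 ≤ (ladderSteps m t d (c + 1)).card := by
  refine Finset.card_lt_card (Finset.ssubset_iff_of_subset ladderSteps_subset_succ |>.2
    ⟨(c, d), ?_, ?_⟩)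
  · exact mem_ladderSteps.2 ⟨hc, by simp, h⟩
  · simp [mem_ladderSteps]

theorem card_ladderSteps_lowerBound_le (ht : SlowMono t) {k i₀ : ℕ} (hcm : c < m)
    (hk : t c = k + 1) (hk1 : t (c + 1) = k + 1) (hi₀ : i₀ ≤ c) (h1 : i₀ = 0 ∨ t i₀ ≤ k)
    (h2 : ∀ i, i₀ < i → i ≤ c → t i = k + 1) :
    (ladderSteps m (lowerBound t c k) d i₀).card ≤ (ladderSteps m t d (c + 1)).card := by
  refine Finset.card_le_card_of_injOn
    (fun p => if i₀ ≤ p.1 ∧ p.1 < c then (p.1 + 1, p.2 + 1) else p) ?_ ?_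
  · intro p hp
    obtain ⟨h3, h4, h5, h6, h7⟩ := mem_ladderSteps.1 hp
    refine mem_ladderSteps.2 ?_
    simp only [lowerBound] at h5 h6 h7
    by_cases hp1 : i₀ ≤ p.1 ∧ p.1 < c
    · simp only [if_pos hp1]
      have e1 : t (p.1 + 1) = k + 1 := h2 _ (by omega) (by omega)
      have e2 : t (p.1 + 1 + 1) = k + 1 := by
        rcases eq_or_ne (p.1 + 1) c with h | h
        · rw [h, hk1]
        · exact h2 _ (by omega) (by omega)
      have e3 := (ht p.1).2
      rw [if_pos hp1.2.le, min_eq_right (by omega)] at h6 h7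
      exact ⟨by omega, by omega, by omega, by omega, by omega⟩
    · simp only [if_neg hp1]
      rcases lt_trichotomy p.1 c with h | h | h
      · have e1 : t (p.1 + 1) ≤ k := by
          rcases h1 with h1 | h1
          · omega
          · exact (ht.monotone (by omega)).trans h1
        have e2 := (ht p.1).1
        rw [if_pos (by omega), if_pos (by omega), min_eq_left e1, min_eq_left (by omega)] at h5
        rw [if_pos (by omega), min_eq_left (by omega)] at h6 h7
        exact ⟨h3, by omega, h5, h6, h7⟩
      · rw [if_neg (by omega), if_pos (by omega), h, hk1, hk, min_eq_right (by omega)] at h5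
        omega
      · rw [if_neg (by omega), if_neg (by omega)] at h5
        rw [if_neg (by omega)] at h6 h7
        exact ⟨h3, by omega, h5, h6, h7⟩
  · rintro ⟨i, j⟩ hp ⟨i', j'⟩ hp' h
    have hne : ∀ q : ℕ × ℕ, q ∈ ladderSteps m (lowerBound t c k) d i₀ → q.1 ≠ c := by
      intro q hq hqc
      have h5 := (mem_ladderSteps.1 hq).2.2.1
      simp only [lowerBound] at h5
      rw [if_neg (by omega), if_pos (by omega), hqc, hk1, hk, min_eq_right (by omega)] at h5
      omega
    have hi := hne _ hp
    have hi' := hne _ hp'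
    simp only at h hi hi'
    split_ifs at h <;> simp only [Prod.mk.injEq] at h ⊢ <;> omega

theorem card_ladderSteps_const (m n : ℕ) {r : ℕ} (hr : 1 ≤ r) :
    (ladderSteps m (fun _ => r) n m).card ≤ (m + 1 - r) * (n + 1 + 1 - r) := by
  have : ladderSteps m (fun _ => r) n m ⊆ Finset.Ico (r - 1) m ×ˢ Finset.Ico (r - 1) (n + 1) := by
    intro p hp
    obtain ⟨h1, h2, -, h3, h4⟩ := mem_ladderSteps.1 hp
    simp only [Finset.mem_product, Finset.mem_Ico] at h3 h4 ⊢
    omega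
  refine (Finset.card_le_card this).trans ?_
  rw [Finset.card_product, Nat.card_Ico, Nat.card_Ico]
  apply le_of_eq
  congr 1 <;> omega

end LadderCount

section LadderDepth

open CategoryTheory

universe u

variable {R : Type u} [CommRing R] {m n : ℕ} {N : ModuleCat.{u} (MvPolynomial (Fin m × Fin n) R)}

/-- The induction step for the vanishing of `Ext` modulo ladder ideals. -/
theorem extVanishesBelow_ladderIdeal_succ {D : ℕ} (c : Fin m) (d : Fin n)
    (ih : ∀ c' ≤ (c : ℕ), ∀ t, SlowMono t → ∀ e, e + (ladderSteps m t d c').card ≤ D →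
      ExtVanishesBelow N (_ ⧸ ladderIdeal R m n t d c') e)
    (t : ℕ → ℕ) (ht : SlowMono t) (e : ℕ) (he : e + (ladderSteps m t d (c + 1)).card ≤ D) :
    ExtVanishesBelow N (_ ⧸ ladderIdeal R m n t d (c + 1)) e := by
  have hsub := Finset.card_le_card (ladderSteps_subset_succ (m := m) (t := t) (d := d) (c := c))
  rcases Nat.eq_zero_or_pos (t 0) with h0 | h0
  · rw [ladderIdeal_eq_top h0]
    exact .of_subsingleton _
  have hpos : ∀ i, 1 ≤ t i := fun i => le_trans h0 (ht.monotone (Nat.zero_le i))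
  rcases eq_or_ne (t (c + 1)) (t c + 1) with hstep | hstep
  · rw [ladderIdeal_succ_of_step hstep]
    exact ih c le_rfl t ht e (by omega)
  obtain ⟨k, hc⟩ : ∃ k, t c = k + 1 := ⟨t c - 1, by have := hpos c; omega⟩
  have hc1 : t (c + 1) = k + 1 := by have := ht c; omega
  by_cases hkcd : k ≤ c ∧ k ≤ d
  swap
  · rw [ladderIdeal_succ_of_lt (by omega)]
    exact ih c le_rfl t ht e (by omega)
  obtain ⟨hkc, hkd⟩ := hkcd
  obtain ⟨p₀, hp₀⟩ := exists_corner_nzd (R := R) ht c d hpos hc hc1 hkc hkd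
    (ladderNzd d d.2 c c.2.le)
  obtain ⟨i₀, hi₀, h1, h2⟩ := exists_last_le t c k ht hc
  have hb : NzdMod (ladderIdeal R m n t d c) (borderedMinor R c d p₀) := by
    have := nzdMod_of_free (v := (c, d)) (idealFreeOf_ladderIdeal le_rfl le_rfl)
      (cornerMinor_mem_freeOf c d p₀) (borderedMinor_sub_mem_freeOf c d p₀) hp₀
    rwa [add_sub_cancel] at this
  have hcard := card_ladderSteps_succ (t := t) (d := d) c.2 ⟨by omega, by omega, by omega⟩
  rw [ladderIdeal_succ_eq_sup_span c d hc hc1]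
  refine ExtVanishesBelow.quotient_of_proportional hp₀ hb
    (fun p => cornerMinor_mul_borderedMinor c d hc hc1 hp₀ p) (ih c le_rfl t ht _ (by omega)) ?_
  rw [span_range_cornerMinor, ← ladderIdeal_lowerBound ht c.2.le hc hi₀ h1 h2]
  refine ih i₀ hi₀ _ (slowMono_lowerBound ht hc hc1) e (le_trans ?_ he)
  have := card_ladderSteps_lowerBound_le (d := d) ht c.2 hc hc1 hi₀ h1 h2
  omega

theorem extVanishesBelow_ladderIdeal {D : ℕ}
    (hD : ExtVanishesBelow N (MvPolynomial (Fin m × Fin n) R) D) :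
    ∀ d < n, ∀ c ≤ m, ∀ t, SlowMono t → ∀ e, e + (ladderSteps m t d c).card ≤ D →
      ExtVanishesBelow N (_ ⧸ ladderIdeal R m n t d c) e := by
  intro d
  induction d with
  | zero =>
    intro hd c
    induction c using Nat.strong_induction_on with
    | _ c ih =>
      intro hc
      rcases c with _ | c
      · intro t ht e he
        rcases Nat.eq_zero_or_pos (t 0) with h0 | h0
        · rw [ladderIdeal_eq_top h0]
          exact .of_subsingleton _
        rw [ladderIdeal_zero_zero fun i _ => le_trans h0 (ht.monotone (Nat.zero_le i))]
        exact (hD.mono (by omega)).of_linearEquiv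
          (Submodule.quotEquivOfEqBot (⊥ : Submodule _ (MvPolynomial (Fin m × Fin n) R)) rfl).symm
      · exact extVanishesBelow_ladderIdeal_succ ⟨c, hc⟩ ⟨0, hd⟩
          fun c' hc' => ih c' (Nat.lt_succ_of_le hc') (le_trans hc' (Nat.le_of_succ_le hc))
  | succ d ihd =>
    intro hd c
    induction c using Nat.strong_induction_on with
    | _ c ih =>
      intro hc
      rcases c with _ | c
      · intro t ht e he
        rcases Nat.eq_zero_or_pos (t 0) with h0 | h0
        · rw [ladderIdeal_eq_top h0]
          exact .of_subsingleton _
        rw [ladderIdeal_succ_zero h0]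
        rw [ladderSteps_succ_zero] at he
        exact ihd (Nat.lt_of_succ_lt hd) m le_rfl t ht e he
      · exact extVanishesBelow_ladderIdeal_succ ⟨c, hc⟩ ⟨d + 1, hd⟩
          fun c' hc' => ih c' (Nat.lt_succ_of_le hc') (le_trans hc' (Nat.le_of_succ_le hc))

/-- Generic determinantal rings: the vanishing of `Ext` drops by at most the expected
codimension. -/
theorem extVanishesBelow_boundedMinors {D : ℕ} (hn : 1 ≤ n)
    (hD : ExtVanishesBelow N (MvPolynomial (Fin m × Fin n) R) D) {r : ℕ} (hr : 1 ≤ r) {e : ℕ}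
    (he : e + (m + 1 - r) * (n + 1 - r) ≤ D) :
    ExtVanishesBelow N
      (_ ⧸ boundedMinors (Matrix.mvPolynomialX (Fin m) (Fin n) R) r m n) e := by
  obtain ⟨d, rfl⟩ : ∃ d, n = d + 1 := ⟨n - 1, by omega⟩
  have hcard := card_ladderSteps_const m d hr
  have h := extVanishesBelow_ladderIdeal hD d (Nat.lt_succ_self d) m le_rfl (fun _ => r)
    (fun _ => ⟨le_rfl, Nat.le_succ _⟩) e (le_trans (by omega) he)
  have heq : ladderIdeal R m (d + 1) (fun _ => r) d m =
      boundedMinors (Matrix.mvPolynomialX (Fin m) (Fin (d + 1)) R) r m (d + 1) := by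
    apply le_antisymm
    · rw [ladderIdeal_le_iff]
      exact ⟨fun i hi => boundedMinors_mono _ _ hi (Nat.le_succ d),
        fun i hi => boundedMinors_mono _ _ hi le_rfl⟩
    · exact boundedMinors_succ_le_ladderIdeal (t := fun _ => r) le_rfl
  rwa [heq] at h

end LadderDepth

section GenericDepth

universe u

open RingTheory.Sequence

theorem NzdMod.isSMulRegular {S : Type*} [CommRing S] {W : Ideal S} {z : S} (h : NzdMod W z) :
    IsSMulRegular (S ⧸ (W • ⊤ : Submodule S S)) z := by
  have hW : (W • ⊤ : Submodule S S) = W := by rw [smul_eq_mul, Ideal.mul_top]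
  rw [hW]
  refine isSMulRegular_iff_right_eq_zero_of_smul.2 fun x hx => ?_
  obtain ⟨x, rfl⟩ := Ideal.Quotient.mk_surjective x
  exact Ideal.Quotient.eq_zero_iff_mem.2 (h x (Ideal.Quotient.eq_zero_iff_mem.1 hx))

variable {R : Type u} [CommRing R] {σ : Type*}

theorem isWeaklyRegular_C_append_X_sub_C [DecidableEq σ] {rs : List R} (h : IsWeaklyRegular R rs)
    (a : σ → R) (l : List σ) (hl : l.Nodup) :
    IsWeaklyRegular (MvPolynomial σ R)
      (rs.map (MvPolynomial.C : R →+* MvPolynomial σ R) ++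
        l.map fun v => MvPolynomial.X v - MvPolynomial.C (a v)) := by
  induction l using List.reverseRecOn with
  | nil =>
    simpa using h.of_flat (S := MvPolynomial σ R)
  | append_singleton l v ih =>
    obtain ⟨hl1, -, hl2⟩ := List.nodup_append.1 hl
    have hv : v ∉ l := fun hv => hl2 v hv v (by simp) rfl
    rw [List.map_append, ← List.append_assoc, isWeaklyRegular_append_iff, List.map_singleton,
      isWeaklyRegular_singleton_iff]
    refine ⟨ih hl1, NzdMod.isSMulRegular ?_⟩
    have hC : ∀ r : R, (MvPolynomial.C r : MvPolynomial σ R) ∈ freeOf R v := fun r => by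
      change splitVar R v _ = _
      simp [splitVar]
    have := nzdMod_of_free (v := v) (W := Ideal.ofList
      (rs.map (MvPolynomial.C : R →+* MvPolynomial σ R) ++
        l.map fun v => MvPolynomial.X v - MvPolynomial.C (a v))) (idealFreeOf_span ?_)
      (one_mem (freeOf R v)) (neg_mem (hC (a v))) (fun u hu => by simpa using hu)
    · rwa [mul_one, ← sub_eq_add_neg] at this
    · intro x hx
      rcases List.mem_append.1 hx with hx | hx <;> obtain ⟨w, hw, rfl⟩ := List.mem_map.1 hx
      · exact hC w
      · refine sub_mem (X_mem_freeOf ?_) (hC _)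
        rintro rfl
        exact hv hw

theorem smul_top_quotient_ne_top {S : Type*} [CommRing S] {I J : Ideal S} (hJ : J ≤ I)
    (hI : I ≠ ⊤) : I • (⊤ : Submodule S (S ⧸ J)) ≠ ⊤ := by
  intro htop
  have hle : I • (⊤ : Submodule S (S ⧸ J)) ≤ Submodule.map J.mkQ I := by
    refine Submodule.smul_le.2 fun x hx y _ => ?_
    obtain ⟨y, rfl⟩ := Ideal.Quotient.mk_surjective y
    exact ⟨x * y, I.mul_mem_right y hx, rfl⟩
  rw [htop] at hle
  obtain ⟨x, hx, h1⟩ := hle (Submodule.mem_top (x := J.mkQ 1))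
  refine hI (I.eq_top_iff_one.2 ?_)
  have := hJ ((Submodule.Quotient.eq J).1 h1)
  simpa using I.sub_mem hx this

theorem exists_isRegular_quotient_boundedMinors [IsLocalRing R] [IsNoetherianRing R]
    {rs : List R} (hrs : ∀ x ∈ rs, x ∈ IsLocalRing.maximalIdeal R) (hreg : IsWeaklyRegular R rs)
    {m n : ℕ} (hn : 1 ≤ n) (a : Fin m × Fin n → R) {r e : ℕ} (hr : 1 ≤ r)
    (he : e + (m + 1 - r) * (n + 1 - r) ≤ rs.length + m * n)
    (hJ : boundedMinors (Matrix.mvPolynomialX (Fin m) (Fin n) R) r m n ≤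
      (IsLocalRing.maximalIdeal R).comap (MvPolynomial.eval a)) :
    ∃ ys : List (MvPolynomial (Fin m × Fin n) R), ys.length = e ∧
      (∀ y ∈ ys, y ∈ (IsLocalRing.maximalIdeal R).comap (MvPolynomial.eval a)) ∧
      IsRegular (_ ⧸ boundedMinors (Matrix.mvPolynomialX (Fin m) (Fin n) R) r m n) ys := by
  classical
  set I := (IsLocalRing.maximalIdeal R).comap (MvPolynomial.eval a) with hI
  set J := boundedMinors (Matrix.mvPolynomialX (Fin m) (Fin n) R) r m n
  have hI1 : I ≠ ⊤ := Ideal.IsPrime.ne_top inferInstance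
  have hsupp : Module.support (MvPolynomial (Fin m × Fin n) R)
      (ModuleCat.of (MvPolynomial (Fin m × Fin n) R) (MvPolynomial (Fin m × Fin n) R ⧸ I)) =
      PrimeSpectrum.zeroLocus I := by
    rw [Module.support_eq_zeroLocus, Ideal.annihilator_quotient]
  have hS : ExtVanishesBelow (ModuleCat.of (MvPolynomial (Fin m × Fin n) R)
      (MvPolynomial (Fin m × Fin n) R ⧸ I))
      (MvPolynomial (Fin m × Fin n) R) (rs.length + m * n) := by
    set zs := rs.map (MvPolynomial.C : R →+* MvPolynomial (Fin m × Fin n) R) ++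
      (Finset.univ : Finset (Fin m × Fin n)).toList.map
        fun v => MvPolynomial.X v - MvPolynomial.C (a v) with hzs
    have hlen : zs.length = rs.length + m * n := by simp [hzs]
    have hmem : ∀ z ∈ zs, z ∈ I := by
      intro z hz
      rcases List.mem_append.1 hz with hz | hz <;> obtain ⟨w, hw, rfl⟩ := List.mem_map.1 hz
      · rw [hI, Ideal.mem_comap, MvPolynomial.eval_C]
        exact hrs w hw
      · simp [hI, Ideal.mem_comap]
    have hle : Ideal.ofList zs ≤ I := Ideal.span_le.2 hmem
    have htop : I • (⊤ : Submodule (MvPolynomial (Fin m × Fin n) R)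
        (MvPolynomial (Fin m × Fin n) R)) < ⊤ := by
      rw [smul_eq_mul, Ideal.mul_top]
      exact hI1.lt_top
    rw [← hlen]
    refine ModuleCat.subsingleton_ext_of_exists_isRegular I _ hsupp.le
      (ModuleCat.of _ (MvPolynomial (Fin m × Fin n) R)) htop zs hmem
      ⟨isWeaklyRegular_C_append_X_sub_C hreg a _ (Finset.nodup_toList _), ?_⟩
    exact (ne_top_of_le_ne_top htop.ne (Submodule.smul_mono_left hle)).symm
  refine ModuleCat.exists_isRegular_of_exists_subsingleton_ext I e
    (ModuleCat.of _ (MvPolynomial (Fin m × Fin n) R ⧸ J)) ?_ _ hsupp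
    (extVanishesBelow_boundedMinors hn hS hr he)
  exact (smul_top_quotient_ne_top hJ hI1).lt_top

end GenericDepth

section LocalAlgebra

universe u

open RingTheory.Sequence IsLocalRing Pointwise

theorem length_le_ringKrullDim_quotient_of_mem_associatedPrimes {R : Type*} [CommRing R]
    [IsLocalRing R] [IsNoetherianRing R] {rs : List R} (hrs : ∀ x ∈ rs, x ∈ maximalIdeal R)
    {M : Type*} [AddCommGroup M] [Module R M] [Module.Finite R M] (h : IsWeaklyRegular M rs)
    {p : Ideal R} (hp : p ∈ associatedPrimes R M) :
    (rs.length : WithBot ℕ∞) ≤ ringKrullDim (R ⧸ p) := by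
  induction rs generalizing M p with
  | nil =>
    have := hp.isPrime
    simpa using ringKrullDim_nonneg_of_nontrivial
  | cons x rs ih =>
    obtain ⟨hx, hreg⟩ := (isWeaklyRegular_cons_iff M x rs).1 h
    have hxm : x ∈ maximalIdeal R := hrs x (by simp)
    obtain ⟨hpp, m, hm⟩ := isAssociatedPrime_iff.1 hp
    set L := Submodule.torsionBySet R M (p : Set R) with hL
    have hmL : m ∈ L := by
      rw [hL, Submodule.mem_torsionBySet_iff]
      rintro ⟨a, ha⟩
      have ha' : a ∈ p := ha
      rw [hm, Submodule.mem_colon_singleton] at ha'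
      simpa using ha'
    have hm0 : m ≠ 0 := by
      rintro rfl
      apply hpp.ne_top
      rw [hm, Ideal.eq_top_iff_one, Submodule.mem_colon_singleton]
      simp
    have hxp : x ∉ p := by
      intro hxp
      rw [hm, Submodule.mem_colon_singleton, Submodule.mem_bot] at hxp
      exact hm0 (hx (by simpa using hxp))
    have : Nontrivial L := ⟨⟨⟨m, hmL⟩, 0, fun h => hm0 (congrArg Subtype.val h)⟩⟩
    have : Nontrivial (QuotSMulTop x L) := nontrivial_quotSMulTop_of_mem_maximalIdeal L hxm
    obtain ⟨q, hq⟩ := associatedPrimes.nonempty R (QuotSMulTop x L)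
    have hinj : Function.Injective (QuotSMulTop.map x L.subtype) := by
      rw [injective_iff_map_eq_zero]
      intro y hy
      obtain ⟨y, rfl⟩ := Submodule.Quotient.mk_surjective _ y
      have hy' : (Submodule.Quotient.mk (y : M) : QuotSMulTop x M) = 0 := hy
      rw [Submodule.Quotient.mk_eq_zero, Submodule.mem_smul_pointwise_iff_exists] at hy'
      obtain ⟨z, -, hz⟩ := hy'
      rw [Submodule.Quotient.mk_eq_zero, Submodule.mem_smul_pointwise_iff_exists]
      refine ⟨⟨z, ?_⟩, Submodule.mem_top, Subtype.ext hz⟩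
      rw [hL, Submodule.mem_torsionBySet_iff]
      intro a
      have hya := (Submodule.mem_torsionBySet_iff _ _).1 y.2 a
      apply hx
      change x • ((a : R) • z) = x • 0
      rw [smul_comm, hz, smul_zero]
      exact hya
    have hlen := ih (fun y hy => hrs y (by simp [hy])) hreg
      (associatedPrimes.subset_of_injective hinj hq)
    obtain ⟨hqp, l, hl⟩ := isAssociatedPrime_iff.1 hq
    obtain ⟨l, rfl⟩ := Submodule.Quotient.mk_surjective _ l
    have hpq : p ≤ q := by
      intro a ha
      rw [hl, Submodule.mem_colon_singleton, Submodule.mem_bot, ← Submodule.Quotient.mk_smul]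
      have : a • l = 0 := Subtype.ext ((Submodule.mem_torsionBySet_iff _ _).1 l.2 ⟨a, ha⟩)
      rw [this, Submodule.Quotient.mk_zero]
    have hxq : x ∈ q := by
      rw [hl, Submodule.mem_colon_singleton, Submodule.mem_bot, ← Submodule.Quotient.mk_smul,
        Submodule.Quotient.mk_eq_zero]
      exact Submodule.smul_mem_pointwise_smul _ _ _ Submodule.mem_top
    refine le_trans ?_ (ringKrullDim_succ_le_of_surjective (Ideal.Quotient.factor hpq)
      (Ideal.Quotient.factor_surjective hpq) (r := Ideal.Quotient.mk p x) ?_ ?_)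
    · rw [List.length_cons]
      push_cast
      gcongr
    · rw [mem_nonZeroDivisors_iff_ne_zero, ne_eq, Ideal.Quotient.eq_zero_iff_mem]
      exact hxp
    · rw [Ideal.Quotient.factor_mk, Ideal.Quotient.eq_zero_iff_mem]
      exact hxq

theorem extVanishesBelow_quotient_sup_ofList {Q : Type u} [CommRing Q] [IsLocalRing Q]
    [IsNoetherianRing Q] {ys : List Q} (hys : ∀ y ∈ ys, y ∈ maximalIdeal Q) {W : Ideal Q}
    (hW : W ≤ maximalIdeal Q) {d : ℕ}
    (hext : ExtVanishesBelow (ModuleCat.of Q (Q ⧸ maximalIdeal Q)) (Q ⧸ W) (d + ys.length))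
    (hdim : ringKrullDim (Q ⧸ (W ⊔ Ideal.ofList ys)) ≤ d) :
    ExtVanishesBelow (ModuleCat.of Q (Q ⧸ maximalIdeal Q)) (Q ⧸ (W ⊔ Ideal.ofList ys)) d := by
  induction ys generalizing W with
  | nil =>
    rw [Ideal.ofList_nil, sup_bot_eq]
    exact hext
  | cons y ys ih =>
    have hy : y ∈ maximalIdeal Q := hys y (by simp)
    have hreg : NzdMod W y := by
      by_contra hcon
      have hsupp : Module.support Q (ModuleCat.of Q (Q ⧸ maximalIdeal Q)) =
          PrimeSpectrum.zeroLocus (maximalIdeal Q) := by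
        rw [Module.support_eq_zeroLocus, Ideal.annihilator_quotient]
      obtain ⟨rs, hlen, hmem, hrs⟩ := ModuleCat.exists_isRegular_of_exists_subsingleton_ext
        (maximalIdeal Q) _ (ModuleCat.of Q (Q ⧸ W))
        (smul_top_quotient_ne_top hW (maximalIdeal.isMaximal Q).ne_top).lt_top _ hsupp hext
      have hyz : y ∈ ⋃ p ∈ associatedPrimes Q (Q ⧸ W), (p : Set Q) := by
        rw [biUnion_associatedPrimes_eq_zero_divisors]
        unfold NzdMod at hcon
        push Not at hcon
        obtain ⟨u, hu, hu'⟩ := hcon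
        refine ⟨Ideal.Quotient.mk W u, ?_, ?_⟩
        · rwa [ne_eq, Ideal.Quotient.eq_zero_iff_mem]
        · exact Ideal.Quotient.eq_zero_iff_mem.2 hu
      simp only [Set.mem_iUnion] at hyz
      obtain ⟨p, hp, hyp⟩ := hyz
      have hpp := hp.isPrime
      have hU := length_le_ringKrullDim_quotient_of_mem_associatedPrimes hmem hrs.1 hp
      have hWp : W ≤ p := by
        have := hp.annihilator_le
        rwa [Submodule.annihilator_top, Ideal.annihilator_quotient] at this
      classical
      set s : Finset (Q ⧸ p) := (ys.map (Ideal.Quotient.mk p)).toFinset with hs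
      have hsmem : ∀ z ∈ ys, Ideal.Quotient.mk p z ∈ s := fun z hz => by
        rw [hs, List.mem_toFinset]
        exact List.mem_map_of_mem hz
      have hcard : s.card ≤ ys.length := by
        simpa using (ys.map (Ideal.Quotient.mk p)).toFinset_card_le
      have hsjac : (s : Set (Q ⧸ p)) ⊆ Ring.jacobson (Q ⧸ p) := by
        have : IsLocalRing (Q ⧸ p) :=
          .of_surjective' (Ideal.Quotient.mk p) Ideal.Quotient.mk_surjective
        rw [ringJacobson_eq_maximalIdeal]
        intro z hz
        rw [hs, List.coe_toFinset] at hz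
        obtain ⟨z, hzs, rfl⟩ := List.mem_map.1 hz
        have := hys z (List.mem_cons_of_mem y hzs)
        rw [SetLike.mem_coe, mem_maximalIdeal, mem_nonunits_iff]
        have hloc : IsLocalHom (Ideal.Quotient.mk p) :=
          .of_surjective _ Ideal.Quotient.mk_surjective
        exact fun hz => this (hloc.map_nonunit z hz)
      have hle := ringKrullDim_le_ringKrullDim_quotient_add_card s hsjac
      have hquot : ringKrullDim ((Q ⧸ p) ⧸ Ideal.span (s : Set (Q ⧸ p))) ≤ d := by
        refine le_trans (ringKrullDim_le_of_surjective (Ideal.Quotient.lift _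
          ((Ideal.Quotient.mk (Ideal.span (s : Set (Q ⧸ p)))).comp (Ideal.Quotient.mk p)) ?_)
          (Ideal.Quotient.lift_surjective_of_surjective _ _
            (Ideal.Quotient.mk_surjective.comp Ideal.Quotient.mk_surjective))) hdim
        have hkill : W ⊔ Ideal.ofList (y :: ys) ≤ RingHom.ker
            ((Ideal.Quotient.mk (Ideal.span (s : Set (Q ⧸ p)))).comp (Ideal.Quotient.mk p)) := by
          have hp0 : p ≤ RingHom.ker
              ((Ideal.Quotient.mk (Ideal.span (s : Set (Q ⧸ p)))).comp (Ideal.Quotient.mk p)) :=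
            fun z hz => by
              rw [RingHom.mem_ker, RingHom.comp_apply, Ideal.Quotient.eq_zero_iff_mem.2 hz,
                map_zero]
          refine sup_le (hWp.trans hp0) (Ideal.span_le.2 fun z hz => ?_)
          rcases List.mem_cons.1 hz with rfl | hz
          · exact hp0 hyp
          · exact Ideal.Quotient.eq_zero_iff_mem.2 (Ideal.subset_span (hsmem z hz))
        exact fun z hz => hkill hz
      rw [hlen] at hU
      have hfin : ((d + (y :: ys).length : ℕ) : WithBot ℕ∞) ≤ ((d + ys.length : ℕ)) := by
        refine hU.trans (hle.trans ?_)
        push_cast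
        exact add_le_add hquot (by exact_mod_cast hcard)
      rw [List.length_cons] at hfin
      have : d + (ys.length + 1) ≤ d + ys.length := by exact_mod_cast hfin
      omega
    have hle : Ideal.ofList (y :: ys) = Ideal.span {y} ⊔ Ideal.ofList ys := Ideal.ofList_cons y ys
    have heq : W ⊔ Ideal.ofList (y :: ys) = (W ⊔ Ideal.span {y}) ⊔ Ideal.ofList ys := by
      rw [hle, sup_assoc]
    rw [heq] at hdim ⊢
    refine ih (fun z hz => hys z (by simp [hz]))
      (sup_le hW ((Ideal.span_singleton_le_iff_mem _).2 hy)) ?_ hdim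
    refine ExtVanishesBelow.of_exact_right (LinearMap.lsmul Q (Q ⧸ W) y)
      (Submodule.factor (le_sup_left : W ≤ W ⊔ Ideal.span {y})) ?_ ?_
      (Submodule.factor_surjective _) (e := d + ys.length)
      hext (hext.mono (by simp))
    · rw [injective_iff_map_eq_zero]
      intro u hu
      obtain ⟨u, rfl⟩ := Ideal.Quotient.mk_surjective u
      exact Ideal.Quotient.eq_zero_iff_mem.2 (hreg u (Ideal.Quotient.eq_zero_iff_mem.1 hu))
    · intro u
      obtain ⟨u, rfl⟩ := Ideal.Quotient.mk_surjective u
      constructor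
      · intro hu
        have hu' : u ∈ W ⊔ Ideal.span {y} := Ideal.Quotient.eq_zero_iff_mem.1 hu
        obtain ⟨w, hw, z, hz, rfl⟩ := Submodule.mem_sup.1 hu'
        obtain ⟨c, rfl⟩ := Ideal.mem_span_singleton'.1 hz
        refine ⟨Ideal.Quotient.mk W c, (Submodule.Quotient.eq W).2 ?_⟩
        simpa [mul_comm c y] using hw
      · rintro ⟨c, hc⟩
        obtain ⟨c, rfl⟩ := Ideal.Quotient.mk_surjective c
        rw [← hc]
        refine Ideal.Quotient.eq_zero_iff_mem.2 (Ideal.mem_sup_right ?_)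
        exact Ideal.mul_mem_right _ _ (Ideal.mem_span_singleton_self y)

end LocalAlgebra

section Specialization

universe u

open RingTheory.Sequence IsLocalRing

theorem exists_isRegular_of_surjective {S : Type u} [CommRing S] [IsNoetherianRing S] {L : Type*}
    [CommRing L] [IsLocalRing L] {g : S →+* L} (hg : Function.Surjective g) {J : Ideal S}
    {ys zs : List S} (hker : RingHom.ker g = J ⊔ Ideal.ofList zs) {d : ℕ}
    (hlen : ys.length = d + zs.length) (hys : ∀ y ∈ ys, y ∈ (maximalIdeal L).comap g)
    (hzs : ∀ z ∈ zs, z ∈ (maximalIdeal L).comap g)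
    (hreg : IsWeaklyRegular (S ⧸ J) ys) (hdim : ringKrullDim L ≤ d) :
    ∃ rs : List L, rs.length = d ∧ (∀ x ∈ rs, x ∈ maximalIdeal L) ∧ IsRegular L rs := by
  set P := (maximalIdeal L).comap g with hP
  have hPprime : P.IsPrime := inferInstance
  set Q := Localization.AtPrime P
  have hunit : ∀ s : P.primeCompl, IsUnit (g s) := by
    rintro ⟨s, hs⟩
    by_contra hcon
    exact hs ((mem_maximalIdeal _).2 hcon)
  set φ : Q →+* L := IsLocalization.lift hunit with hφ
  have hφg : ∀ s, φ (algebraMap S Q s) = g s := fun s => IsLocalization.lift_eq hunit s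
  have hφs : Function.Surjective φ := fun l => by
    obtain ⟨s, rfl⟩ := hg l
    exact ⟨_, hφg s⟩
  set W := J.map (algebraMap S Q) with hWdef
  set zs' := zs.map (algebraMap S Q) with hzs'
  have hmap : W ⊔ Ideal.ofList zs' = (RingHom.ker g).map (algebraMap S Q) := by
    rw [hker, Ideal.map_sup, Ideal.map_ofList]
  have hkerφ : RingHom.ker φ = W ⊔ Ideal.ofList zs' := by
    rw [hmap]
    refine le_antisymm (fun x hx => ?_) (Ideal.map_le_iff_le_comap.2 fun s hs => ?_)
    · obtain ⟨s, t, rfl⟩ := IsLocalization.exists_mk'_eq P.primeCompl x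
      have hs : g s = 0 := by
        rw [← hφg, ← IsLocalization.mk'_spec Q s t, map_mul, RingHom.mem_ker.1 hx, zero_mul]
      rw [IsLocalization.mk'_eq_mul_mk'_one]
      exact Ideal.mul_mem_right _ _ (Ideal.mem_map_of_mem _ hs)
    · rw [Ideal.mem_comap, RingHom.mem_ker, hφg]
      exact hs
  let ε : Q ⧸ (W ⊔ Ideal.ofList zs') ≃+* L :=
    (Ideal.quotEquivOfEq hkerφ.symm).trans (RingHom.quotientKerEquivOfSurjective hφs)
  have hεφ : ∀ x, ε (Ideal.Quotient.mk _ x) = φ x := fun x => rfl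
  have hmemQ : ∀ s ∈ P, algebraMap S Q s ∈ maximalIdeal Q := fun s hs =>
    (IsLocalization.AtPrime.to_map_mem_maximal_iff Q P s).2 hs
  have hle : W ⊔ Ideal.ofList zs' ≤ maximalIdeal Q := by
    rw [← hkerφ]
    exact le_maximalIdeal (RingHom.ker_ne_top φ)
  have hW : W ≤ maximalIdeal Q := le_sup_left.trans hle
  have hsupp : Module.support Q (ModuleCat.of Q (Q ⧸ maximalIdeal Q)) =
      PrimeSpectrum.zeroLocus (maximalIdeal Q) := by
    rw [Module.support_eq_zeroLocus, Ideal.annihilator_quotient]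
  have hregW : IsRegular (Q ⧸ W) (ys.map (algebraMap S Q)) := by
    have hloc : J.localized' Q P.primeCompl (Algebra.linearMap S Q) = W :=
      Ideal.localized'_eq_map ..
    have hnt : Nontrivial (Q ⧸ W) := Ideal.Quotient.nontrivial_iff.2
      (ne_top_of_le_ne_top (maximalIdeal.isMaximal Q).ne_top hW)
    rw [← hloc] at hnt ⊢
    exact hreg.isRegular_of_isLocalizedModule_of_mem Q P
      (J.toLocalizedQuotient' Q P.primeCompl (Algebra.linearMap S Q)) hys
  have hext : ExtVanishesBelow (ModuleCat.of Q (Q ⧸ maximalIdeal Q)) (Q ⧸ W)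
      (d + zs'.length) := by
    have := ModuleCat.subsingleton_ext_of_exists_isRegular (maximalIdeal Q) _ hsupp.le
      (ModuleCat.of Q (Q ⧸ W))
      (smul_top_quotient_ne_top hW (maximalIdeal.isMaximal Q).ne_top).lt_top
      (ys.map (algebraMap S Q)) (by
        intro y hy
        obtain ⟨y, hy', rfl⟩ := List.mem_map.1 hy
        exact hmemQ y (hys y hy')) hregW
    rwa [List.length_map, hlen, ← List.length_map (algebraMap S Q)] at this
  have hext' := extVanishesBelow_quotient_sup_ofList (fun z hz => by
      obtain ⟨z, hz', rfl⟩ := List.mem_map.1 hz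
      exact hmemQ z (hzs z hz')) hW hext (by rwa [ringKrullDim_eq_of_ringEquiv ε])
  obtain ⟨rs, hrslen, hrsmem, hrs⟩ := ModuleCat.exists_isRegular_of_exists_subsingleton_ext
    (maximalIdeal Q) d (ModuleCat.of Q (Q ⧸ (W ⊔ Ideal.ofList zs')))
    (smul_top_quotient_ne_top hle (maximalIdeal.isMaximal Q).ne_top).lt_top _ hsupp hext'
  refine ⟨rs.map φ, by rw [List.length_map, hrslen], ?_, ?_⟩
  · intro x hx
    obtain ⟨x, hx', rfl⟩ := List.mem_map.1 hx
    have hl : IsLocalHom φ := .of_surjective φ hφs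
    exact map_nonunit φ x (hrsmem x hx')
  · refine (AddEquiv.isRegular_congr (e := ε.toAddEquiv) ?_).1 hrs
    refine List.forall₂_map_right_iff.2 (List.forall₂_same.2 fun r _ x => ?_)
    obtain ⟨x, rfl⟩ := Ideal.Quotient.mk_surjective x
    change φ (r * x) = φ r * φ x
    exact map_mul φ r x

theorem ker_eval_eq_ofList {R σ : Type*} [CommRing R] [Fintype σ] (a : σ → R) :
    RingHom.ker (MvPolynomial.eval a) = Ideal.ofList
      (Finset.univ.toList.map fun v => MvPolynomial.X v - MvPolynomial.C (a v)) := by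
  set zs := Finset.univ.toList.map fun v => MvPolynomial.X v - MvPolynomial.C (a v)
  apply le_antisymm
  · intro p hp
    have hcomp : Ideal.Quotient.mk (Ideal.ofList zs) =
        ((Ideal.Quotient.mk (Ideal.ofList zs)).comp MvPolynomial.C).comp (MvPolynomial.eval a) := by
      refine MvPolynomial.ringHom_ext
        (fun r => by rw [RingHom.comp_apply, RingHom.comp_apply, MvPolynomial.eval_C]) fun v => ?_
      rw [RingHom.comp_apply, MvPolynomial.eval_X, RingHom.comp_apply,
        Ideal.Quotient.mk_eq_mk_iff_sub_mem]
      exact Ideal.subset_span (show _ ∈ zs from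
        List.mem_map.2 ⟨v, Finset.mem_toList.2 (Finset.mem_univ v), rfl⟩)
    rw [← Ideal.Quotient.eq_zero_iff_mem, hcomp, RingHom.comp_apply, RingHom.mem_ker.1 hp, map_zero]
  · refine Ideal.span_le.2 fun z hz => ?_
    obtain ⟨v, -, rfl⟩ := List.mem_map.1 hz
    simp [RingHom.mem_ker]

theorem exists_isRegular_of_ker_eq_map_boundedMinors {R : Type u} [CommRing R] [IsLocalRing R]
    [IsNoetherianRing R] {rs : List R} (hrs : ∀ x ∈ rs, x ∈ maximalIdeal R)
    (hreg : IsWeaklyRegular R rs) {m n : ℕ} (hn : 1 ≤ n) (a : Fin m × Fin n → R) {r d : ℕ}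
    (hr : 1 ≤ r) (hd : d + (m + 1 - r) * (n + 1 - r) ≤ rs.length) {L : Type*} [CommRing L]
    [IsLocalRing L] {f : R →+* L} (hf : Function.Surjective f)
    (hker : RingHom.ker f = (boundedMinors (Matrix.mvPolynomialX (Fin m) (Fin n) R) r m n).map
      (MvPolynomial.eval a)) (hdim : ringKrullDim L ≤ d) :
    ∃ xs : List L, xs.length = d ∧ (∀ x ∈ xs, x ∈ maximalIdeal L) ∧ IsRegular L xs := by
  set J := boundedMinors (Matrix.mvPolynomialX (Fin m) (Fin n) R) r m n
  have hloc : IsLocalHom f := .of_surjective f hf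
  have hmax : (maximalIdeal L).comap f = maximalIdeal R := maximalIdeal_comap f
  have hsurj : Function.Surjective (MvPolynomial.eval a) := fun x => ⟨MvPolynomial.C x, by simp⟩
  have hJ : J ≤ (maximalIdeal R).comap (MvPolynomial.eval a) := by
    rw [← Ideal.map_le_iff_le_comap, ← hker]
    exact le_maximalIdeal (RingHom.ker_ne_top f)
  obtain ⟨ys, hlen, hmem, hys⟩ := exists_isRegular_quotient_boundedMinors hrs hreg hn a
    (e := d + m * n) hr (by omega) hJ
  have hcomap : (maximalIdeal L).comap (f.comp (MvPolynomial.eval a)) =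
      (maximalIdeal R).comap (MvPolynomial.eval a) := by
    rw [← Ideal.comap_comap, hmax]
  refine exists_isRegular_of_surjective (g := f.comp (MvPolynomial.eval a)) (J := J)
    (zs := Finset.univ.toList.map fun v => MvPolynomial.X v - MvPolynomial.C (a v))
    (hf.comp hsurj) ?_ (by simpa using hlen) (by rwa [hcomap]) ?_ hys.1 hdim
  · rw [← ker_eval_eq_ofList, ← RingHom.comap_ker, hker, Ideal.comap_map_of_surjective _ hsurj,
      RingHom.ker_eq_comap_bot]
  · rw [hcomap]
    intro z hz
    obtain ⟨v, -, rfl⟩ := List.mem_map.1 hz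
    simp [Ideal.mem_comap]

end Specialization

section CohenMacaulay

open RingTheory.Sequence IsLocalRing

theorem natCast_add_le_ringKrullDim_of_surjective {R L : Type*} [CommRing R] [CommRing L]
    {f : R →+* L} (hf : Function.Surjective f) {h n : ℕ}
    (hmin : ∀ p ∈ (RingHom.ker f).minimalPrimes, (h : ℕ∞) ≤ p.height)
    (hn : (n : WithBot ℕ∞) ≤ ringKrullDim L) : ((n + h : ℕ) : WithBot ℕ∞) ≤ ringKrullDim R := by
  obtain ⟨l, rfl⟩ := Order.le_krullDim_iff.1 hn
  set l' := l.map (PrimeSpectrum.comap f)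
    (Monotone.strictMono_of_injective (fun p q hpq => Ideal.comap_mono hpq)
      (PrimeSpectrum.comap_injective_of_surjective f hf)) with hl'
  have hle : RingHom.ker f ≤ l'.head.asIdeal := by
    rw [hl', LTSeries.head_map, PrimeSpectrum.comap_asIdeal]
    exact Ideal.ker_le_comap f
  obtain ⟨p, hp, hple⟩ := Ideal.exists_minimalPrimes_le hle
  have hheight : (h : ℕ∞) ≤ Order.height l'.head := by
    rw [← PrimeSpectrum.height_eq_orderHeight]
    exact (hmin p hp).trans (Ideal.height_mono hple)
  obtain ⟨s, hs, rfl⟩ := Order.exists_series_of_le_height _ hheight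
  have := Order.LTSeries.length_le_krullDim (s.smash l' hs)
  rw [RelSeries.smash_length] at this
  rw [add_comm]
  exact this

theorem isCMLocalRing_of_isRegular {L : Type*} [CommRing L] [IsLocalRing L] [IsNoetherianRing L]
    {rs : List L} (hrs : ∀ x ∈ rs, x ∈ maximalIdeal L) (hreg : IsRegular L rs)
    (hdim : ringKrullDim L = rs.length) : IsCMLocalRing L := by
  refine ⟨inferInstance, fun M hM => ?_⟩
  obtain rfl := eq_maximalIdeal hM
  rw [hdim]
  suffices idealDepth (maximalIdeal L) = rs.length by rw [this]; rfl
  refine le_antisymm (iSup₂_le fun xs hxs => ?_) (le_iSup₂_of_le rs ⟨hrs, hreg⟩ le_rfl)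
  have h1 := ringKrullDim_add_length_eq_ringKrullDim_of_isRegular xs hxs.2
  have : Nontrivial (L ⧸ Ideal.ofList xs) := by
    refine Ideal.Quotient.nontrivial_iff.2 ?_
    exact ne_top_of_le_ne_top (maximalIdeal.isMaximal L).ne_top (Ideal.span_le.2 hxs.1)
  rw [hdim] at h1
  have h2 : (xs.length : WithBot ℕ∞) ≤ rs.length := by
    rw [← h1]
    exact le_add_of_nonneg_left ringKrullDim_nonneg_of_nontrivial
  exact_mod_cast h2

theorem IsCMLocalRing.exists_isRegular {R : Type*} [CommRing R] [IsLocalRing R]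
    (h : IsCMLocalRing R) {d : ℕ} (hd : (d : WithBot ℕ∞) ≤ ringKrullDim R) :
    ∃ rs : List R, d ≤ rs.length ∧ (∀ x ∈ rs, x ∈ maximalIdeal R) ∧ IsRegular R rs := by
  rcases d with _ | d
  · exact ⟨[], by simp, by simp, .nil R R⟩
  · rw [← h.2 (maximalIdeal R) (maximalIdeal.isMaximal R)] at hd
    have hd' : ((d + 1 : ℕ) : ℕ∞) ≤ idealDepth (maximalIdeal R) := by exact_mod_cast hd
    have hlt : (d : ℕ∞) < idealDepth (maximalIdeal R) :=
      lt_of_lt_of_le (by exact_mod_cast Nat.lt_succ_self d) hd'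
    obtain ⟨rs, hlt⟩ := lt_iSup_iff.1 hlt
    obtain ⟨hrs, hlt⟩ := lt_iSup_iff.1 hlt
    exact ⟨rs, by exact_mod_cast hlt, hrs⟩

theorem map_boundedMinors_eq_map_detIdeal {R R' : Type*} [CommRing R] [CommRing R'] {m n : ℕ}
    (φ : R →+* R') (A : Matrix (Fin m) (Fin n) R) (t : ℤ) :
    (boundedMinors (Matrix.mvPolynomialX (Fin m) (Fin n) R') t.toNat m n).map
      (MvPolynomial.eval fun v => φ (A v.1 v.2)) = (detIdeal A t).map φ := by
  have key : ∀ (f : Fin t.toNat → Fin m) (g : Fin t.toNat → Fin n),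
      MvPolynomial.eval (fun v => φ (A v.1 v.2))
        ((Matrix.mvPolynomialX (Fin m) (Fin n) R').submatrix f g).det =
      φ (A.submatrix f g).det := by
    intro f g
    rw [RingHom.map_det, RingHom.map_det]
    congr 1
    ext i j
    simp
  apply le_antisymm
  · rw [Ideal.map_le_iff_le_comap, boundedMinors_le_iff]
    intro f g _ _
    rw [Ideal.mem_comap, key]
    by_cases hf : Function.Injective f
    · by_cases hg : Function.Injective g
      · exact Ideal.mem_map_of_mem _ (Ideal.subset_span ⟨f, g, hf, hg, rfl⟩)
      · rw [det_submatrix_eq_zero_of_not_injective_right _ _ hg, map_zero]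
        exact zero_mem _
    · rw [det_submatrix_eq_zero_of_not_injective _ _ hf, map_zero]
      exact zero_mem _
  · rw [detIdeal, Ideal.map_span, Ideal.span_le]
    rintro _ ⟨_, ⟨f, g, -, -, rfl⟩, rfl⟩
    rw [← key]
    exact Ideal.mem_map_of_mem _ (det_mem_boundedMinors _ (fun l => (f l).2) fun l => (g l).2)

theorem ker_localRingHom_mk {R : Type*} [CommRing R] (I : Ideal R) (p : Ideal (R ⧸ I))
    [p.IsPrime] :
    RingHom.ker (Localization.localRingHom (p.comap (Ideal.Quotient.mk I)) p
      (Ideal.Quotient.mk I) rfl) =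
    I.map (algebraMap R (Localization.AtPrime (p.comap (Ideal.Quotient.mk I)))) := by
  refine le_antisymm (fun x hx => ?_) (Ideal.map_le_iff_le_comap.2 fun s hs => ?_)
  · obtain ⟨x, s, rfl⟩ := IsLocalization.exists_mk'_eq
      (p.comap (Ideal.Quotient.mk I)).primeCompl x
    rw [RingHom.mem_ker, Localization.localRingHom_mk', IsLocalization.mk'_eq_zero_iff] at hx
    obtain ⟨⟨t, ht⟩, htx⟩ := hx
    obtain ⟨t, rfl⟩ := Ideal.Quotient.mk_surjective t
    have htx' : t * x ∈ I := by
      rw [← Ideal.Quotient.eq_zero_iff_mem, map_mul]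
      exact htx
    have hu := IsLocalization.map_units
      (Localization.AtPrime (p.comap (Ideal.Quotient.mk I)))
      (⟨t, ht⟩ : (p.comap (Ideal.Quotient.mk I)).primeCompl)
    rw [IsLocalization.mk'_eq_mul_mk'_one]
    refine Ideal.mul_mem_right _ _ ((Ideal.unit_mul_mem_iff_mem _ hu).1 ?_)
    rw [← map_mul]
    exact Ideal.mem_map_of_mem _ htx'
  · rw [Ideal.mem_comap, RingHom.mem_ker, Localization.localRingHom_to_map,
      Ideal.Quotient.eq_zero_iff_mem.2 hs, map_zero]

theorem isCMLocalRing_localization_quotient_detIdeal {R : Type*} [CommRing R]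
    [IsNoetherianRing R]
    (hCM : ∀ (q : Ideal R) (_ : q.IsPrime), IsCMLocalRing (Localization.AtPrime q))
    {m n : ℕ} (hn : 1 ≤ n) (A : Matrix (Fin m) (Fin n) R) (hA : HasGoodDegLoci A) (k : ℕ) {t : ℤ}
    (ht : t = (n : ℤ) - k + 1) (hproper : detIdeal A t ≠ ⊤) (p : Ideal (R ⧸ detIdeal A t))
    [p.IsPrime] : IsCMLocalRing (Localization.AtPrime p) := by
  set q := p.comap (Ideal.Quotient.mk (detIdeal A t))
  have ht1 : 1 ≤ t := by
    by_contra hcon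
    have h0 : t.toNat = 0 := by omega
    apply hproper
    rw [Ideal.eq_top_iff_one]
    refine Ideal.subset_span ?_
    rw [Set.mem_ofPred_eq, h0]
    exact ⟨Fin.elim0, Fin.elim0, fun i => i.elim0, fun i => i.elim0, by simp⟩
  set f := Localization.localRingHom q p (Ideal.Quotient.mk (detIdeal A t)) rfl
  have hf : Function.Surjective f := (RingHom.surjectiveOnStalks_of_surjective
    Ideal.Quotient.mk_surjective).localRingHom_surjective q p rfl
  have hker : RingHom.ker f = (detIdeal A t).map (algebraMap R (Localization.AtPrime q)) :=
    ker_localRingHom_mk _ p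
  have : IsNoetherianRing (Localization.AtPrime p) := isNoetherianRing_of_surjective _ _ f hf
  set h := (m + 1 - t.toNat) * (n + 1 - t.toNat) with hh
  have hheight : ((max 0 ((k : ℤ) * ((k : ℤ) - ((n : ℤ) - (m : ℤ))))).toNat) = h := by
    have h1 : n + 1 - t.toNat = k := by omega
    rw [hh, h1]
    rcases le_total (n : ℤ) (m + k) with hle | hle
    · have h2 : ((m + 1 - t.toNat : ℕ) : ℤ) = k - (n - m) := by omega
      rw [← h2, max_eq_right (by positivity), mul_comm]
      exact_mod_cast Int.toNat_natCast _
    · have h2 : m + 1 - t.toNat = 0 := by omega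
      rw [h2, zero_mul, max_eq_left, Int.toNat_zero]
      exact mul_nonpos_of_nonneg_of_nonpos (by positivity) (by omega)
  have hmin : ∀ P ∈ (RingHom.ker f).minimalPrimes, (h : ℕ∞) ≤ P.height := by
    intro P hP
    rw [hker, IsLocalization.minimalPrimes_map q.primeCompl] at hP
    have hPp : (P.under R).IsPrime := hP.isPrime
    rw [← IsLocalization.height_under q.primeCompl P]
    have := hA k ⟨P.under R, hPp⟩ (ht ▸ hP)
    rw [hheight, ← PrimeSpectrum.height_eq_orderHeight] at this
    exact this.ge
  obtain ⟨d, hd⟩ : ∃ d : ℕ, ringKrullDim (Localization.AtPrime p) = d := by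
    obtain ⟨a, ha⟩ := WithBot.ne_bot_iff_exists.1
      (ringKrullDim_ne_bot (R := Localization.AtPrime p))
    have ha' : a ≠ ⊤ := fun h =>
      ringKrullDim_ne_top (R := Localization.AtPrime p) (by rw [← ha, h]; rfl)
    lift a to ℕ using ha'
    exact ⟨a, ha.symm⟩
  obtain ⟨rs, hlen, hrs, hreg⟩ := (hCM q inferInstance).exists_isRegular
    (natCast_add_le_ringKrullDim_of_surjective hf hmin hd.ge)
  obtain ⟨xs, hxlen, hxs, hxreg⟩ := exists_isRegular_of_ker_eq_map_boundedMinors hrs hreg.1 hn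
    (fun v => algebraMap R (Localization.AtPrime q) (A v.1 v.2)) (r := t.toNat) (by omega) hlen hf
    (by rw [hker, map_boundedMinors_eq_map_detIdeal]) hd.le
  exact isCMLocalRing_of_isRegular hxs hxreg (by rw [hd, hxlen])

end CohenMacaulay

/-- If `R` is a commutative Noetherian ring all of whose localizations at primes are
Cohen–Macaulay local rings, and `A` is an `m × n` matrix over `R` with good degeneracy
loci, then for every `k ≥ 0` with `I_{n-k+1}(A)` proper, the quotient `R / I_{n-k+1}(A)`
is Cohen–Macaulay: its localization at every prime is a Cohen–Macaulay local ring. -/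
theorem quotient_detIdeal_isCM_of_hasGoodDegLoci
    {R : Type*} [CommRing R] [IsNoetherianRing R]
    (hCM : ∀ (q : Ideal R) (hq : q.IsPrime), IsCMLocalRing (Localization.AtPrime q))
    {m n : ℕ} (hm : 1 ≤ m) (hn : 1 ≤ n) (A : Matrix (Fin m) (Fin n) R)
    (hA : HasGoodDegLoci A) (k : ℕ) (hproper : detIdeal A ((n : ℤ) - k + 1) ≠ ⊤) :
    ∀ (p : Ideal (R ⧸ detIdeal A ((n : ℤ) - k + 1))) (hp : p.IsPrime),
      IsCMLocalRing (Localization.AtPrime p) := by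
  exact fun p _ => isCMLocalRing_localization_quotient_detIdeal hCM hn A hA k rfl hproper p
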